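/- arXiv:1802.09449 — 2 statements merged into one kernel-verified Lean document; each statement's English description precedes it below -/
import Mathlib

section
/- Let p > 2 be a prime, G = PSL₂(p), and let A ⊆ G be a maximal coclique which is not the underlying set of a maximal subgroup of G. Suppose A contains an element x of order greater than 2 whose order divides p + 1. If G contains A₄ as a maximal subgroup, then |A| ≤ (9/2)(p + 1) + 1, i.e. 2·|A| ≤ 9(p + 1) + 2. -/
open scoped MatrixGroups

/-- A subset `A` of a group `G` is a *coclique* if any two of its elements
generate a proper subgroup of `G`. -/
def IsCoclique {G : Type*} [Group G] (A : Set G) : Prop :=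
  ∀ g ∈ A, ∀ h ∈ A, Subgroup.closure {g, h} ≠ ⊤

/-- A coclique is *maximal* if the only coclique containing it is itself. -/
def IsMaximalCoclique {G : Type*} [Group G] (A : Set G) : Prop :=
  IsCoclique A ∧ ∀ B : Set G, IsCoclique B → A ⊆ B → A = B

/-- `G` contains a maximal subgroup isomorphic to `H`. -/
def HasMaximalSubgroupIsoTo (G : Type*) [Group G] (H : Type*) [Group H] : Prop :=
  ∃ M : Subgroup G, IsCoatom M ∧ Nonempty (M ≃* H)

section SpecialLinear

variable {F : Type*} [Field F]

local notation "π" => (QuotientGroup.mk : SL(2, F) → PSL(2, F))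

theorem mul_entries (A B : SL(2, F)) :
    (A * B) 0 0 = A 0 0 * B 0 0 + A 0 1 * B 1 0 ∧ (A * B) 0 1 = A 0 0 * B 0 1 + A 0 1 * B 1 1 ∧
    (A * B) 1 0 = A 1 0 * B 0 0 + A 1 1 * B 1 0 ∧ (A * B) 1 1 = A 1 0 * B 0 1 + A 1 1 * B 1 1 := by
  simp [Matrix.mul_apply, Fin.sum_univ_two]

theorem inv_entries (A : SL(2, F)) :
    A⁻¹ 0 0 = A 1 1 ∧ A⁻¹ 0 1 = -A 0 1 ∧ A⁻¹ 1 0 = -A 1 0 ∧ A⁻¹ 1 1 = A 0 0 := by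
  simp [Matrix.adjugate_fin_two]

theorem neg_entries (A : SL(2, F)) :
    (-A) 0 0 = -A 0 0 ∧ (-A) 0 1 = -A 0 1 ∧ (-A) 1 0 = -A 1 0 ∧ (-A) 1 1 = -A 1 1 := by
  simp

theorem one_entries :
    (1 : SL(2, F)) 0 0 = 1 ∧ (1 : SL(2, F)) 0 1 = 0 ∧ (1 : SL(2, F)) 1 0 = 0 ∧
    (1 : SL(2, F)) 1 1 = 1 := by
  simp

theorem ext_entries {A B : SL(2, F)} :
    A = B ↔ A 0 0 = B 0 0 ∧ A 0 1 = B 0 1 ∧ A 1 0 = B 1 0 ∧ A 1 1 = B 1 1 := by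
  refine ⟨by rintro rfl; simp, fun ⟨h1, h2, h3, h4⟩ => ?_⟩
  ext i j
  fin_cases i <;> fin_cases j <;> assumption

theorem det_entries (A : SL(2, F)) : A 0 0 * A 1 1 - A 0 1 * A 1 0 = 1 := by
  have := A.det_coe
  rwa [Matrix.det_fin_two] at this

/-- The trace of an element of `SL(2, F)`. -/
def slTrace (A : SL(2, F)) : F := A 0 0 + A 1 1

theorem mk_eq_mk_iff (A B : SL(2, F)) : π A = π B ↔ A = B ∨ A = -B := by
  rw [QuotientGroup.eq, Matrix.SpecialLinearGroup.mem_center_iff]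
  constructor
  · rintro ⟨r, hr, h⟩
    have hr' : r = 1 ∨ r = -1 := sq_eq_one_iff.1 (by simpa using hr)
    have h' : A⁻¹ * B = 1 ∨ A⁻¹ * B = -1 := by
      rcases hr' with rfl | rfl
      · left
        ext i j
        rw [← h]
        fin_cases i <;> fin_cases j <;> simp
      · right
        ext i j
        rw [← h]
        fin_cases i <;> fin_cases j <;> simp
    rcases h' with h' | h'
    · left; rw [inv_mul_eq_one.1 h']
    · right; rw [inv_mul_eq_iff_eq_mul.1 h']; simp
  · rintro (rfl | rfl)
    · exact ⟨1, by simp⟩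
    · refine ⟨-1, by simp, ?_⟩
      ext i j
      fin_cases i <;> fin_cases j <;> simp

theorem slTrace_neg (A : SL(2, F)) : slTrace (-A) = -slTrace A := by
  simp [slTrace]; ring

theorem slTrace_conj (A B : SL(2, F)) : slTrace (B * A * B⁻¹) = slTrace A := by
  have h := det_entries B
  simp only [slTrace, mul_entries, inv_entries]
  linear_combination (A 0 0 + A 1 1) * h

theorem sq_eq (A : SL(2, F)) :
    (A * A) 0 0 = slTrace A * A 0 0 - 1 ∧ (A * A) 0 1 = slTrace A * A 0 1 ∧
    (A * A) 1 0 = slTrace A * A 1 0 ∧ (A * A) 1 1 = slTrace A * A 1 1 - 1 := by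
  have h := det_entries A
  simp only [slTrace, mul_entries]
  refine ⟨?_, ?_, ?_, ?_⟩ <;> first | linear_combination -h | ring

theorem mk_eq_one_iff (A : SL(2, F)) : π A = 1 ↔ A = 1 ∨ A = -1 := mk_eq_mk_iff A 1

theorem mk_eq_one_iff_entries (A : SL(2, F)) :
    π A = 1 ↔ A 0 1 = 0 ∧ A 1 0 = 0 ∧ A 0 0 = A 1 1 := by
  rw [mk_eq_one_iff, ext_entries, ext_entries]
  have h := det_entries A
  simp only [neg_entries, one_entries]
  constructor
  · rintro (h | h) <;> grind
  · rintro ⟨h1, h2, h3⟩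
    have : A 1 1 = 1 ∨ A 1 1 = -1 := sq_eq_one_iff.1 (by grind)
    grind

theorem slTrace_eq_zero_of_sq (A : SL(2, F)) (h1 : π A ≠ 1)
    (h2 : π A ^ 2 = 1) : slTrace A = 0 := by
  rw [← QuotientGroup.mk_pow, mk_eq_one_iff_entries, pow_two] at h2
  simp only [sq_eq] at h2
  rw [Ne, mk_eq_one_iff_entries] at h1
  grind

theorem slTrace_sq_eq_one_of_cube (A : SL(2, F)) (h1 : π A ≠ 1)
    (h2 : π A ^ 3 = 1) : slTrace A ^ 2 = 1 := by
  rw [← QuotientGroup.mk_pow, mk_eq_one_iff_entries, pow_succ, pow_two] at h2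
  rw [Ne, mk_eq_one_iff_entries] at h1
  obtain ⟨a, b, c, d⟩ := sq_eq A
  have e := det_entries A
  simp only [(mul_entries (A * A) A).1, (mul_entries (A * A) A).2.1, (mul_entries (A * A) A).2.2.1,
    (mul_entries (A * A) A).2.2.2, a, b, c, d] at h2
  obtain ⟨x, y, z⟩ := h2
  have hs : slTrace A = A 0 0 + A 1 1 := rfl
  have x' : (slTrace A ^ 2 - 1) * A 0 1 = 0 := by rw [← x]; simp only [slTrace]; ring
  have y' : (slTrace A ^ 2 - 1) * A 1 0 = 0 := by rw [← y]; simp only [slTrace]; ring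
  have z' : (slTrace A ^ 2 - 1) * (A 0 0 - A 1 1) = 0 := by
    linear_combination z + (slTrace A * A 0 0 - slTrace A * A 1 1) * hs
  grind

theorem exists_golden_of_pow_five (A : SL(2, F)) (h1 : π A ≠ 1)
    (h2 : π A ^ 5 = 1) : ∃ φ : F, φ ^ 2 = φ + 1 := by
  have e := det_entries A
  obtain ⟨a, b, c, d⟩ := sq_eq A
  obtain ⟨a', b', c', d'⟩ := sq_eq (A * A)
  have h3 : A * A * (A * A) = A⁻¹ ∨ A * A * (A * A) = -A⁻¹ := by
    rw [← mk_eq_mk_iff]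
    rw [QuotientGroup.mk_inv, eq_inv_iff_mul_eq_one, ← h2, ← QuotientGroup.mk_pow,
      ← QuotientGroup.mk_mul]
    congr 1
    simp only [pow_succ, pow_zero, one_mul, mul_assoc]
  rw [Ne, mk_eq_one_iff_entries] at h1
  have ht : slTrace (A * A) = slTrace A ^ 2 - 2 := by
    rw [slTrace, a, d, slTrace]; ring
  rw [ext_entries, ext_entries, a', b', c', d', ht, a, b, c, d] at h3
  simp only [neg_entries, inv_entries] at h3
  have hs : slTrace A = A 0 0 + A 1 1 := rfl
  generalize slTrace A = t at *
  rcases h3 with ⟨h3, h4, h5, h6⟩ | ⟨h3, h4, h5, h6⟩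
  · refine ⟨-t, ?_⟩
    have h7 : (t ^ 3 - 2 * t + 1) * A 0 1 = 0 := by linear_combination h4
    have h8 : (t ^ 3 - 2 * t + 1) * A 1 0 = 0 := by linear_combination h5
    have h9 : (t ^ 3 - 2 * t + 1) * (A 0 0 - A 1 1) = 0 := by linear_combination h3 - h6
    have h10 : t ^ 3 - 2 * t + 1 = 0 := by grind
    linear_combination (-1 : F) * h3 + A 0 0 * h10 + hs
  · refine ⟨t, ?_⟩
    have h7 : (t ^ 3 - 2 * t - 1) * A 0 1 = 0 := by linear_combination h4
    have h8 : (t ^ 3 - 2 * t - 1) * A 1 0 = 0 := by linear_combination h5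
    have h9 : (t ^ 3 - 2 * t - 1) * (A 0 0 - A 1 1) = 0 := by linear_combination h3 - h6
    have h10 : t ^ 3 - 2 * t - 1 = 0 := by grind
    linear_combination (-1 : F) * h3 + A 0 0 * h10 - hs

end SpecialLinear

theorem ncard_conic_le {F : Type*} [Field F] [Finite F] (α β γ δ ε ζ : F)
    (h : ∀ u w : F, α * u ^ 2 + β * (u * w) + γ * w ^ 2 = 0 → u = 0 ∧ w = 0) :
    {v : F × F | α * v.1 ^ 2 + β * (v.1 * v.2) + γ * v.2 ^ 2 + δ * v.1 + ε * v.2 + ζ = 0}.ncard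
      ≤ Nat.card F + 2 := by
  classical
  set C := {v : F × F | α * v.1 ^ 2 + β * (v.1 * v.2) + γ * v.2 ^ 2 + δ * v.1 + ε * v.2 + ζ = 0}
    with hC
  rcases C.eq_empty_or_nonempty with h0 | ⟨⟨u₀, w₀⟩, h0⟩
  · simp [h0]
  have key : (C \ {(u₀, w₀)}).ncard ≤ (Set.univ : Set (Option F)).ncard := by
    refine Set.ncard_le_ncard_of_injOn
      (fun v => if v.2 = w₀ then none else some ((v.1 - u₀) / (v.2 - w₀))) (by simp) ?_
    rintro ⟨u₁, w₁⟩ ⟨h1, h1'⟩ ⟨u₂, w₂⟩ ⟨h2, h2'⟩ h12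
    simp only [hC, Set.mem_ofPred_eq, Set.mem_singleton_iff,
      Prod.mk.injEq] at h0 h1 h1' h2 h2' h12 ⊢
    split_ifs at h12 with e1 e2 e2
    · subst e1 e2
      have : α ≠ 0 := by
        intro hα
        exact one_ne_zero (h 1 0 (by simp [hα])).1
      grind
    · rw [Option.some_inj] at h12
      obtain ⟨s, hs⟩ : ∃ s, (u₁ - u₀) / (w₁ - w₀) = s := ⟨_, rfl⟩
      have hq : α * s ^ 2 + β * s + γ ≠ 0 := by
        intro hq
        exact one_ne_zero (h s 1 (by linear_combination hq)).2
      have e1' : w₁ - w₀ ≠ 0 := sub_ne_zero.2 e1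
      have e2' : w₂ - w₀ ≠ 0 := sub_ne_zero.2 e2
      rw [hs] at h12
      have g1 : u₁ = u₀ + s * (w₁ - w₀) := by rw [← hs]; field_simp; ring
      have g2 : u₂ = u₀ + s * (w₂ - w₀) := by rw [h12]; field_simp; ring
      have k1 : (w₁ - w₀) * ((α * s ^ 2 + β * s + γ) * (w₁ - w₀) +
          (2 * α * u₀ * s + β * u₀ + β * s * w₀ + 2 * γ * w₀ + δ * s + ε)) = 0 := by
        rw [g1] at h1
        linear_combination h1 - h0
      have k2 : (w₂ - w₀) * ((α * s ^ 2 + β * s + γ) * (w₂ - w₀) +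
          (2 * α * u₀ * s + β * u₀ + β * s * w₀ + 2 * γ * w₀ + δ * s + ε)) = 0 := by
        rw [g2] at h2
        linear_combination h2 - h0
      have k3 : (α * s ^ 2 + β * s + γ) * (w₁ - w₂) = 0 := by
        linear_combination (mul_eq_zero.1 k1).resolve_left e1' -
          (mul_eq_zero.1 k2).resolve_left e2'
      have k4 : w₁ = w₂ := sub_eq_zero.1 ((mul_eq_zero.1 k3).resolve_left hq)
      exact ⟨by rw [g1, g2, k4], k4⟩
  have h1 : (Set.univ : Set (Option F)).ncard = Nat.card F + 1 := by
    rw [Set.ncard_univ, Finite.card_option]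
  have h2 := Set.ncard_sdiff_singleton_add_one h0 (Set.toFinite _)
  omega

section SpecialLinear

variable {F : Type*} [Field F]

local notation "π" => (QuotientGroup.mk : SL(2, F) → PSL(2, F))

/-- An element of `SL(2, F)` is *elliptic* if its characteristic polynomial has no root in `F`. -/
def IsElliptic (X : SL(2, F)) : Prop := ∀ z : F, z ^ 2 - slTrace X * z + 1 ≠ 0

theorem IsElliptic.entry_ne_zero {X : SL(2, F)} (hX : IsElliptic X) : X 1 0 ≠ 0 := by
  intro h
  apply hX (X 0 0)
  have := det_entries X
  rw [h] at this
  simp only [slTrace]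
  linear_combination -this

theorem IsElliptic.anisotropic {X : SL(2, F)} (hX : IsElliptic X) (u w : F)
    (h : X 1 0 * u ^ 2 + (X 1 1 - X 0 0) * (u * w) + -X 0 1 * w ^ 2 = 0) : u = 0 ∧ w = 0 := by
  have hc := hX.entry_ne_zero
  have hw : w = 0 := by
    by_contra hw
    apply hX (X 1 0 * (u / w) + X 1 1)
    have := det_entries X
    simp only [slTrace]
    field_simp
    linear_combination X 1 0 * h + w ^ 2 * (-this)
  subst hw
  refine ⟨?_, rfl⟩
  grind

theorem slTrace_ne_zero_of_sq_ne_one {X : SL(2, F)} (h : (π X) ^ 2 ≠ 1) : slTrace X ≠ 0 := by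
  intro h0
  apply h
  rw [← QuotientGroup.mk_pow, mk_eq_one_iff_entries, pow_two]
  simp only [sq_eq, h0]
  simp

theorem entries_of_commute {X Y : SL(2, F)} (h : Y * X = X * Y) :
    Y 0 1 * X 1 0 = X 0 1 * Y 1 0 ∧ (Y 0 0 - Y 1 1) * X 1 0 = Y 1 0 * (X 0 0 - X 1 1) := by
  rw [ext_entries] at h
  simp only [mul_entries] at h
  grind

theorem IsElliptic.ncard_centralizer_le [Finite F] {X : SL(2, F)} (hX : IsElliptic X) :
    {Y : SL(2, F) | Y * X = X * Y}.ncard ≤ Nat.card F + 2 := by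
  have hc := hX.entry_ne_zero
  refine le_trans (Set.ncard_le_ncard_of_injOn (fun Y => (Y 0 0, Y 1 0)) ?_ ?_)
    (ncard_conic_le (X 1 0) (X 1 1 - X 0 0) (-X 0 1) 0 0 (-X 1 0) hX.anisotropic)
  · intro Y hY
    have := det_entries Y
    have h := entries_of_commute hY
    simp only [Set.mem_ofPred_eq]
    linear_combination X 1 0 * this + Y 0 0 * h.2 + Y 1 0 * h.1
  · intro Y hY Z hZ h
    simp only [Prod.mk.injEq] at h
    have h1 := entries_of_commute hY
    have h2 := entries_of_commute hZ
    rw [ext_entries]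
    grind

theorem IsElliptic.ncard_traces_le [Finite F] {X : SL(2, F)} (hX : IsElliptic X) :
    {T : SL(2, F) | slTrace T = 0 ∧ slTrace (X * T) = 1}.ncard ≤ Nat.card F + 2 := by
  have hc := hX.entry_ne_zero
  refine le_trans (Set.ncard_le_ncard_of_injOn (fun Y => (Y 0 0, Y 1 0)) ?_ ?_)
    (ncard_conic_le (X 1 0) (X 1 1 - X 0 0) (-X 0 1) 0 1 (X 1 0) hX.anisotropic)
  · intro Y ⟨h1, h2⟩
    have := det_entries Y
    simp only [slTrace, mul_entries] at h1 h2
    simp only [Set.mem_ofPred_eq]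
    linear_combination -X 1 0 * this - Y 1 0 * h2 + (X 1 0 * Y 0 0 + X 1 1 * Y 1 0) * h1
  · intro Y ⟨h1, h2⟩ Z ⟨h3, h4⟩ h
    simp only [Prod.mk.injEq] at h
    simp only [slTrace, mul_entries] at h1 h2 h3 h4
    rw [ext_entries]
    have e1 : Y 1 1 = Z 1 1 := by grind
    have e2 : X 1 0 * (Y 0 1 - Z 0 1) = 0 := by grind
    grind

theorem ncard_mk_cube_le [Finite F] {X : SL(2, F)} (hX : IsElliptic X) (hX2 : π X ^ 2 ≠ 1) :
    {t : PSL(2, F) | t ^ 2 = 1 ∧ t ≠ 1 ∧ (π X * t) ^ 3 = 1}.ncard ≤ Nat.card F + 2 := by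
  refine le_trans ?_ hX.ncard_traces_le
  refine le_trans (Set.ncard_le_ncard ?_ (Set.toFinite _)) (Set.ncard_image_le (f := π)
    (Set.toFinite {T : SL(2, F) | slTrace T = 0 ∧ slTrace (X * T) = 1}))
  rintro t ⟨h1, h2, h3⟩
  obtain ⟨T, rfl⟩ := QuotientGroup.mk_surjective t
  have h4 := slTrace_eq_zero_of_sq T h2 h1
  have h5 : slTrace (X * T) ^ 2 = 1 := by
    apply slTrace_sq_eq_one_of_cube
    · intro h
      apply hX2
      rw [QuotientGroup.mk_mul] at h
      rw [eq_inv_of_mul_eq_one_left h, inv_pow, h1, inv_one]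
    · rwa [QuotientGroup.mk_mul]
  rcases sq_eq_one_iff.1 h5 with h5 | h5
  · exact ⟨T, ⟨h4, h5⟩, rfl⟩
  · refine ⟨-T, ⟨by rw [slTrace_neg, h4, neg_zero], ?_⟩, (mk_eq_mk_iff _ _).2 (Or.inr rfl)⟩
    rw [mul_neg, slTrace_neg, h5, neg_neg]

theorem mk_commute_iff {X Y : SL(2, F)} (h0 : slTrace X ≠ 0) (hF : (2 : F) ≠ 0) :
    π Y * π X = π X * π Y ↔ Y * X = X * Y := by
  rw [← QuotientGroup.mk_mul, ← QuotientGroup.mk_mul]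
  refine ⟨fun h => ?_, fun h => by rw [h]⟩
  rcases (mk_eq_mk_iff _ _).1 h with h | h
  · exact h
  · exfalso
    have : Y * X * Y⁻¹ = -X := by rw [h]; simp
    have h2 := slTrace_conj X Y
    rw [this, slTrace_neg] at h2
    grind

theorem even_ncard_centralizer {X : SL(2, F)} [Finite F] (hF : (2 : F) ≠ 0) :
    2 ∣ {Y : SL(2, F) | Y * X = X * Y}.ncard := by
  let C : Subgroup (SL(2, F)) := Subgroup.centralizer {X}
  have h1 : {Y : SL(2, F) | Y * X = X * Y} = C := by
    ext Y
    simp [C, Subgroup.mem_centralizer_singleton_iff]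
  rw [h1]
  have h2 : (-1 : SL(2, F)) ∈ C := by
    simp [C, Subgroup.mem_centralizer_singleton_iff]
  have h3 : orderOf (⟨-1, h2⟩ : C) = 2 := by
    rw [Subgroup.orderOf_mk]
    apply orderOf_eq_prime
    · simp
    · rw [Ne, ext_entries]
      simp only [neg_entries, one_entries]
      grind
  have := orderOf_dvd_natCard (⟨-1, h2⟩ : C)
  rwa [h3] at this

theorem IsElliptic.ncard_centralizer_le' [Finite F] {X : SL(2, F)} (hX : IsElliptic X)
    (hF : (2 : F) ≠ 0) (hodd : Odd (Nat.card F)) :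
    {Y : SL(2, F) | Y * X = X * Y}.ncard ≤ Nat.card F + 1 := by
  have h1 := hX.ncard_centralizer_le
  obtain ⟨k, hk⟩ := even_ncard_centralizer (X := X) hF
  obtain ⟨m, hm⟩ := hodd
  omega

theorem two_mul_ncard_le_preimage [Finite F] (hF : (2 : F) ≠ 0) (S : Set PSL(2, F)) :
    2 * S.ncard ≤ (π ⁻¹' S).ncard := by
  have h1 : (π ⁻¹' S).ncard = Nat.card (Subgroup.center SL(2, F)) * S.ncard := by
    rw [← Nat.card_coe_set_eq, ← Nat.card_coe_set_eq S, ← Nat.card_prod]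
    exact Nat.card_congr (QuotientGroup.preimageMkEquivSubgroupProdSet _ _)
  rw [h1]
  refine Nat.mul_le_mul_right _ ?_
  have : Nontrivial (Subgroup.center SL(2, F)) := by
    refine ⟨⟨1, ⟨-1, ?_⟩, ?_⟩⟩
    · rw [← QuotientGroup.eq_one_iff, mk_eq_one_iff]; right; rfl
    · rw [Ne, Subtype.ext_iff, ext_entries]
      simp only [neg_entries, one_entries, OneMemClass.coe_one]
      grind
  exact Finite.one_lt_card

/-- The elements conjugating `x` to itself or its inverse. -/
def invertingSet {G : Type*} [Group G] (x : G) : Set G := {g | g * x = x * g ∨ g * x = x⁻¹ * g}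

theorem ncard_invertingSet_le {G : Type*} [Group G] [Finite G] (x : G) :
    (invertingSet x).ncard ≤ 2 * {y | y * x = x * y}.ncard := by
  set C := {y | y * x = x * y} with hC
  by_cases h : ∃ g, g * x = x⁻¹ * g
  · obtain ⟨g, hg⟩ := h
    have : invertingSet x ⊆ C ∪ (fun y => g * y) '' C := by
      rintro y (hy | hy)
      · exact Or.inl hy
      · refine Or.inr ⟨g⁻¹ * y, ?_, by simp⟩
        have hg' : g⁻¹ * x⁻¹ = x * g⁻¹ := by
          rw [inv_mul_eq_iff_eq_mul, ← mul_assoc, hg]; simp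
        simp only [hC, Set.mem_ofPred_eq]
        rw [mul_assoc, hy, ← mul_assoc, hg', mul_assoc]
    have h1 := Set.ncard_le_ncard this (Set.toFinite _)
    have h2 := Set.ncard_union_le C ((fun y => g * y) '' C)
    have h3 := Set.ncard_image_le (f := fun y => g * y) (Set.toFinite C)
    omega
  · have : invertingSet x ⊆ C := by
      rintro y (hy | hy)
      · exact hy
      · exact (h ⟨y, hy⟩).elim
    have h1 := Set.ncard_le_ncard this (Set.toFinite _)
    omega

theorem IsElliptic.ncard_invertingSet_mk_le [Finite F] {X : SL(2, F)} (hX : IsElliptic X)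
    (hX2 : π X ^ 2 ≠ 1) (hF : (2 : F) ≠ 0) (hodd : Odd (Nat.card F)) :
    (invertingSet (π X)).ncard ≤ Nat.card F + 1 := by
  have h1 : (invertingSet (π X)).ncard ≤ 2 * {y : PSL(2, F) | y * π X = π X * y}.ncard :=
    ncard_invertingSet_le (π X)
  have h2 := two_mul_ncard_le_preimage hF {y : PSL(2, F) | y * π X = π X * y}
  have h3 : π ⁻¹' {y : PSL(2, F) | y * π X = π X * y} = {Y : SL(2, F) | Y * X = X * Y} := by
    ext Y
    exact mk_commute_iff (slTrace_ne_zero_of_sq_ne_one hX2) hF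
  rw [h3] at h2
  have h4 := hX.ncard_centralizer_le' hF hodd
  omega

end SpecialLinear

section SpecialLinear

variable {F : Type*} [Field F]

local notation "π" => (QuotientGroup.mk : SL(2, F) → PSL(2, F))

theorem IsElliptic.conj {X : SL(2, F)} (hX : IsElliptic X) (P : SL(2, F)) :
    IsElliptic (P * X * P⁻¹) := by
  unfold IsElliptic
  rw [slTrace_conj]
  exact hX

/-- The upper unitriangular matrix with parameter `s`. -/
def upperUnip (s : F) : SL(2, F) := ⟨!![1, s; 0, 1], by simp⟩

/-- The lower unitriangular matrix with parameter `s`. -/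
def lowerUnip (s : F) : SL(2, F) := ⟨!![1, 0; s, 1], by simp⟩

theorem upperUnip_entries (s : F) : upperUnip s 0 0 = 1 ∧ upperUnip s 0 1 = s ∧
    upperUnip s 1 0 = 0 ∧ upperUnip s 1 1 = 1 := by
  simp [upperUnip]

theorem lowerUnip_entries (s : F) : lowerUnip s 0 0 = 1 ∧ lowerUnip s 0 1 = 0 ∧
    lowerUnip s 1 0 = s ∧ lowerUnip s 1 1 = 1 := by
  simp [lowerUnip]

theorem upperUnip_pow (s : F) (n : ℕ) : upperUnip s ^ n = upperUnip (n * s) := by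
  induction n with
  | zero => rw [ext_entries]; simp [upperUnip_entries]
  | succ n ih =>
    rw [pow_succ, ih, ext_entries]
    simp only [mul_entries, upperUnip_entries]
    push_cast
    refine ⟨?_, ?_, ?_, ?_⟩ <;> ring

theorem eq_upper_lower_upper {A : SL(2, F)} (h : A 1 0 ≠ 0) :
    upperUnip ((A 0 0 - 1) / A 1 0) * lowerUnip (A 1 0) * upperUnip ((A 1 1 - 1) / A 1 0) = A := by
  have := det_entries A
  rw [ext_entries]
  simp only [mul_entries, upperUnip_entries, lowerUnip_entries]
  refine ⟨?_, ?_, ?_, ?_⟩ <;> field_simp <;> grind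

theorem eq_top_of_upperUnip_mem {K : Subgroup SL(2, F)} (h1 : ∀ s, upperUnip s ∈ K)
    {A : SL(2, F)} (hA : A ∈ K) (hA' : A 1 0 ≠ 0) : K = ⊤ := by
  have key : ∀ B ∈ K, ∀ C : SL(2, F), B 1 0 ≠ 0 → C 1 0 = B 1 0 → C ∈ K := by
    intro B hB C hB0 hC0
    rw [← eq_upper_lower_upper (A := C) (by rwa [hC0]), hC0]
    refine K.mul_mem (K.mul_mem (h1 _) ?_) (h1 _)
    have h2 : (upperUnip ((B 0 0 - 1) / B 1 0))⁻¹ * B * (upperUnip ((B 1 1 - 1) / B 1 0))⁻¹ =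
        lowerUnip (B 1 0) := by
      rw [mul_inv_eq_iff_eq_mul, inv_mul_eq_iff_eq_mul, ← mul_assoc, eq_upper_lower_upper hB0]
    rw [← h2]
    exact K.mul_mem (K.mul_mem (K.inv_mem (h1 _)) hB) (K.inv_mem (h1 _))
  have key2 : ∀ s, s ≠ 0 → lowerUnip s ∈ K := by
    intro s hs
    by_contra hcon
    have hA2 : ∀ n, A * upperUnip n ∈ K := fun n => K.mul_mem hA (h1 _)
    have hAA : ∀ n, A * upperUnip n * A ∈ K := fun n => K.mul_mem (hA2 n) hA
    apply hcon
    have h3 : (A * upperUnip ((s / A 1 0 - A 0 0 - A 1 1) / A 1 0) * A) 1 0 = s := by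
      simp only [mul_entries, upperUnip_entries]
      field_simp
      ring
    refine key _ (hAA ((s / A 1 0 - A 0 0 - A 1 1) / A 1 0)) _ (by rwa [h3]) ?_
    rw [h3, (lowerUnip_entries s).2.2.1]
  have key3 : ∀ B : SL(2, F), B 1 0 ≠ 0 → B ∈ K := fun B hB =>
    key (lowerUnip (B 1 0)) (key2 _ hB) B (by rwa [(lowerUnip_entries _).2.2.1])
      (by rw [(lowerUnip_entries _).2.2.1])
  rw [eq_top_iff]
  intro B _
  by_cases hB : B 1 0 = 0
  · have h4 : (lowerUnip (1 : F) * B) 1 0 ≠ 0 := by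
      have := det_entries B
      simp only [mul_entries, lowerUnip_entries]
      grind
    have h5 := key3 _ h4
    exact (K.mul_mem_cancel_left (key2 1 one_ne_zero)).1 h5
  · exact key3 B hB

theorem exists_of_entries (a b c d : F) (h : a * d - b * c = 1) :
    ∃ P : SL(2, F), P 0 0 = a ∧ P 0 1 = b ∧ P 1 0 = c ∧ P 1 1 = d :=
  ⟨⟨!![a, b; c, d], by rw [Matrix.det_fin_two_of, h]⟩, by simp⟩

theorem exists_conj_lower_left_eq_zero {A : SL(2, F)} {z : F}
    (hz : z ^ 2 - slTrace A * z + 1 = 0) :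
    ∃ P : SL(2, F), (P * A * P⁻¹) 1 0 = 0 ∧ (P * A * P⁻¹) 0 0 = z := by
  have hd := det_entries A
  have hs : slTrace A = A 0 0 + A 1 1 := rfl
  by_cases hc : A 1 0 = 0
  · by_cases ha : A 0 0 = z
    · exact ⟨1, by simpa using hc, by simpa using ha⟩
    · have ha' : A 1 1 = z := by grind
      have had : A 0 0 - A 1 1 ≠ 0 := by grind
      obtain ⟨P, h1, h2, h3, h4⟩ := exists_of_entries 0 1 (-1) (-A 0 1 / (A 0 0 - A 1 1)) (by simp)
      refine ⟨P, ?_⟩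
      rw [(mul_entries _ _).1, (mul_entries _ _).2.2.1]
      simp only [mul_entries, inv_entries, h1, h2, h3, h4, hc]
      constructor
      · field_simp
        ring
      · grind
  · obtain ⟨P, h1, h2, h3, h4⟩ := exists_of_entries 0 (1 / A 1 0) (-A 1 0) (z - A 1 1)
      (by field_simp; simp)
    refine ⟨P, ?_⟩
    simp only [mul_entries, inv_entries, h1, h2, h3, h4]
    constructor
    · grind
    · field_simp
      grind

theorem upperTriangular_pow {A : SL(2, F)} (hA : A 1 0 = 0) (n : ℕ) :
    (A ^ n) 1 0 = 0 ∧ (A ^ n) 0 0 = A 0 0 ^ n ∧ (A ^ n) 1 1 = A 1 1 ^ n := by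
  induction n with
  | zero => simp
  | succ n ih =>
    rw [pow_succ, pow_succ, pow_succ]
    simp only [mul_entries, ih, hA]
    simp

theorem eq_upperUnip {A : SL(2, F)} (h1 : A 1 0 = 0) (h2 : A 0 0 = 1) : A = upperUnip (A 0 1) := by
  have := det_entries A
  rw [ext_entries]
  simp only [upperUnip_entries]
  grind

end SpecialLinear

section Prime

variable {p : ℕ} [Fact p.Prime]

local notation "π" => (QuotientGroup.mk : SL(2, ZMod p) → PSL(2, ZMod p))

theorem isElliptic_of_orderOf {X : SL(2, ZMod p)} (h1 : 2 < orderOf (π X))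
    (h2 : orderOf (π X) ∣ p + 1) : IsElliptic X := by
  intro z hz
  have hp : p.Prime := Fact.out
  obtain ⟨P, hP, hP'⟩ := exists_conj_lower_left_eq_zero hz
  have hz0 : z ≠ 0 := by rintro rfl; simp at hz
  have h3 := upperTriangular_pow hP (p - 1)
  rw [hP', ZMod.pow_card_sub_one_eq_one hz0] at h3
  have h4 : (P * X * P⁻¹) ^ ((p - 1) * p) = 1 := by
    rw [pow_mul, eq_upperUnip h3.1 h3.2.1, upperUnip_pow, ext_entries]
    simp [upperUnip_entries]
  have h5 : X ^ ((p - 1) * p) = 1 := by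
    rw [conj_pow] at h4
    exact conj_eq_one_iff.1 h4
  have h6 : orderOf (π X) ∣ (p - 1) * p := by
    rw [orderOf_dvd_iff_pow_eq_one, ← QuotientGroup.mk_pow, h5, QuotientGroup.mk_one]
  have h7 : Nat.Coprime (orderOf (π X)) p := by
    rw [Nat.coprime_comm, hp.coprime_iff_not_dvd]
    intro h
    have := h.trans h2
    have h8 := (Nat.dvd_add_right (dvd_refl p)).1 this
    exact hp.one_lt.ne' (Nat.dvd_one.1 h8)
  have h8 := h7.dvd_of_dvd_mul_right h6
  have h9 : orderOf (π X) ∣ (p + 1) - (p - 1) := Nat.dvd_sub h2 h8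
  have h10 : p + 1 - (p - 1) = 2 := by have := hp.one_lt; omega
  rw [h10] at h9
  exact absurd (Nat.le_of_dvd two_pos h9) (by omega)

theorem eq_top_of_parabolic_mem {K : Subgroup SL(2, ZMod p)} {X U : SL(2, ZMod p)}
    (hX : IsElliptic X) (hXK : X ∈ K) (hUK : U ∈ K) (hU : π U ≠ 1) (hU2 : slTrace U = 2) :
    K = ⊤ := by
  obtain ⟨P, hP, hP'⟩ := exists_conj_lower_left_eq_zero (A := U) (z := 1) (by rw [hU2]; ring)
  have h1 := eq_upperUnip hP hP'
  set s := (P * U * P⁻¹) 0 1 with hs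
  have hs0 : s ≠ 0 := by
    intro h0
    rw [h0] at h1
    apply hU
    have : P * U * P⁻¹ = 1 := by
      rw [h1, ext_entries]; simp [upperUnip_entries]
    rw [conj_eq_one_iff] at this
    rw [this, QuotientGroup.mk_one]
  have h2 : K.map (MulAut.conj P).toMonoidHom = ⊤ := by
    refine eq_top_of_upperUnip_mem (A := P * X * P⁻¹) ?_ ⟨X, hXK, rfl⟩ (hX.conj P).entry_ne_zero
    intro t
    have h3 : upperUnip t = (P * U * P⁻¹) ^ (t / s).val := by
      rw [h1, upperUnip_pow]
      congr 1
      rw [ZMod.natCast_val, ZMod.cast_id]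
      field_simp
    rw [h3]
    have h4 : P * U * P⁻¹ ∈ K.map (MulAut.conj P).toMonoidHom := ⟨U, hUK, rfl⟩
    exact pow_mem h4 _
  rw [eq_top_iff]
  intro Y _
  have : (MulAut.conj P) Y ∈ K.map (MulAut.conj P).toMonoidHom := by rw [h2]; trivial
  obtain ⟨Y', hY', h⟩ := this
  exact (MulAut.conj P).injective h ▸ hY'

end Prime

theorem orbit_sizes_of_sum {ι : Type*} [Fintype ι] (f : ι → ℕ) (h : ℕ) (hf : ∀ i, f i ∣ h)
    (hh : 0 < h) (hsum : ∑ i, (h - f i) = 2 * h - 2) (i₀ : ι) (hi₀ : 3 * f i₀ ≤ h) :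
    f i₀ = 1 ∨ f i₀ = 2 ∨ h = 12 ∧ f i₀ = 4 ∨ h = 24 ∨ h = 60 := by
  classical
  have hpos : ∀ i, 0 < f i := fun i => Nat.pos_of_dvd_of_pos (hf i) hh
  have hp0 := hpos i₀
  set S := Finset.univ.filter fun i => f i < h with hS
  have hsumS : ∑ i ∈ S, (h - f i) = 2 * h - 2 := by
    rw [← hsum]
    refine Finset.sum_subset (Finset.subset_univ _) fun i _ hi => ?_
    simp only [hS, Finset.mem_filter, Finset.mem_univ, true_and, not_lt] at hi
    omega
  have half : ∀ i ∈ S, ∃ e, 2 ≤ e ∧ f i * e = h := by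
    intro i hi
    simp only [hS, Finset.mem_filter, Finset.mem_univ, true_and] at hi
    obtain ⟨e, he⟩ := hf i
    refine ⟨e, ?_, he.symm⟩
    by_contra hlt
    have : e ≤ 1 := by omega
    interval_cases e <;> omega
  have hi₀S : i₀ ∈ S := by simp [hS]; omega
  have hcard : S.card ≤ 3 := by
    have h1 : S.card • h ≤ ∑ i ∈ S, 2 * (h - f i) := by
      refine Finset.card_nsmul_le_sum _ _ _ fun i hi => ?_
      obtain ⟨e, he, he'⟩ := half i hi
      have : f i * 2 ≤ f i * e := Nat.mul_le_mul_left _ he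
      omega
    rw [← Finset.mul_sum, hsumS, smul_eq_mul] at h1
    by_contra hlt
    have : 4 * h ≤ S.card * h := Nat.mul_le_mul_right _ (by omega)
    omega
  rw [← Finset.add_sum_erase S _ hi₀S] at hsumS
  have hcard' := Finset.card_erase_of_mem hi₀S
  have hS' : ∀ i ∈ S.erase i₀, i ∈ S := fun i hi => Finset.mem_of_mem_erase hi
  generalize S.erase i₀ = S' at *
  have : S'.card = 0 ∨ S'.card = 1 ∨ S'.card = 2 := by omega
  rcases this with h0 | h1 | h2
  · rw [Finset.card_eq_zero] at h0
    subst h0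
    simp at hsumS
    omega
  · obtain ⟨j, rfl⟩ := Finset.card_eq_one.1 h1
    have := hpos j
    obtain ⟨e, he, he'⟩ := half j (hS' j (by simp))
    have : f j * 2 ≤ f j * e := Nat.mul_le_mul_left _ he
    simp at hsumS
    omega
  · obtain ⟨j, k, hjk, rfl⟩ := Finset.card_eq_two.1 h2
    obtain ⟨a, ha⟩ := hf i₀
    obtain ⟨b, hb, hb'⟩ := half j (hS' j (by simp))
    obtain ⟨c, hc, hc'⟩ := half k (hS' k (by simp))
    rw [Finset.sum_pair hjk] at hsumS
    have hj := hpos j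
    have hk := hpos k
    generalize f i₀ = x at *
    generalize f j = y at *
    generalize f k = z at *
    have e1 : y * 2 ≤ y * b := Nat.mul_le_mul_left _ hb
    have e2 : z * 2 ≤ z * c := Nat.mul_le_mul_left _ hc
    have e3 : x + y + z = h + 2 := by omega
    have hb5 : b ≤ 5 := by
      by_contra hlt
      have : y * 6 ≤ y * b := Nat.mul_le_mul_left _ (by omega)
      omega
    have hc5 : c ≤ 5 := by
      by_contra hlt
      have : z * 6 ≤ z * c := Nat.mul_le_mul_left _ (by omega)
      omega
    by_cases ha5 : a ≤ 5
    · clear hsumS hcard hcard' hi₀S hS' half hpos h2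
      interval_cases a <;> interval_cases b <;> interval_cases c <;> omega
    · have : x * 6 ≤ x * a := Nat.mul_le_mul_left _ (by omega)
      clear hsumS hcard hcard' hi₀S hS' half hpos h2
      interval_cases b <;> interval_cases c <;> omega

theorem card_of_two_fixed_points {G Ω : Type*} [Group G] [Finite G] [Finite Ω] [MulAction G Ω]
    (z : G) (hz1 : z ≠ 1) (hz2 : z ^ 2 = 1) (hz : ∀ P : Ω, z • P = P)
    (hfix : ∀ g : G, g ≠ 1 → g ≠ z → (MulAction.fixedBy Ω g).ncard = 2) (P : Ω)
    (hP : 6 ≤ Nat.card (MulAction.stabilizer G P)) :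
    (MulAction.stabilizer G P).index = 1 ∨ (MulAction.stabilizer G P).index = 2 ∨
      Nat.card G = 24 ∧ Nat.card (MulAction.stabilizer G P) = 6 ∨
      Nat.card G = 48 ∨ Nat.card G = 120 := by
  classical
  have := Fintype.ofFinite G
  have := Fintype.ofFinite Ω
  have hzo : orderOf z = 2 := orderOf_eq_prime hz2 hz1
  have hst : ∀ Q : Ω, 2 ∣ Nat.card (MulAction.stabilizer G Q) := by
    intro Q
    have h1 := Subgroup.orderOf_dvd_natCard _ (show z ∈ MulAction.stabilizer G Q from hz Q)
    rwa [hzo] at h1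
  have hcardG : ∀ Q : Ω, (MulAction.orbit G Q).ncard * Nat.card (MulAction.stabilizer G Q)
      = Nat.card G := by
    intro Q
    rw [← MulAction.index_stabilizer, Subgroup.index_mul_card]
  obtain ⟨h, hh⟩ : 2 ∣ Nat.card G := hzo ▸ orderOf_dvd_natCard z
  have hpos : 0 < Nat.card G := Nat.card_pos
  let f : MulAction.orbitRel.Quotient G Ω → ℕ := fun ω => ω.orbit.ncard
  have hf : ∀ ω, f ω ∣ h := by
    intro ω
    induction ω using Quotient.inductionOn' with
    | h Q =>
      obtain ⟨m, hm⟩ := hst Q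
      have h1 := hcardG Q
      rw [hm, hh] at h1
      refine ⟨m, ?_⟩
      change h = (MulAction.orbit G Q).ncard * m
      nlinarith
  have hsum : ∑ ω, f ω = Fintype.card Ω := by
    rw [Fintype.card_congr (MulAction.selfEquivSigmaOrbits' G Ω), Fintype.card_sigma]
    refine Finset.sum_congr rfl fun ω _ => ?_
    rw [← Nat.card_eq_fintype_card, Nat.card_coe_set_eq]
  have hB := MulAction.sum_card_fixedBy_eq_card_orbits_mul_card_group G Ω
  have hB2 : ∑ g : G, Fintype.card (MulAction.fixedBy Ω g)
      = Fintype.card Ω + Fintype.card Ω + (Nat.card G - 2) * 2 := by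
    rw [← Finset.add_sum_erase _ _ (Finset.mem_univ (1 : G)),
      ← Finset.add_sum_erase _ _ (Finset.mem_erase.2 ⟨hz1, Finset.mem_univ z⟩), ← add_assoc]
    congr 1
    · congr 1
      · exact Fintype.card_congr ((Equiv.setCongr (by ext; simp)).trans (Equiv.Set.univ Ω))
      · refine Fintype.card_congr ((Equiv.setCongr (t := Set.univ) ?_).trans (Equiv.Set.univ Ω))
        ext Q
        simp [hz]
    · rw [Finset.sum_const_nat (m := 2)]
      · rw [Finset.card_erase_of_mem (Finset.mem_erase.2 ⟨hz1, Finset.mem_univ z⟩),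
          Finset.card_erase_of_mem (Finset.mem_univ _), Finset.card_univ,
          Nat.card_eq_fintype_card, Nat.sub_sub]
      · intro g hg
        simp only [Finset.mem_erase, Finset.mem_univ, and_true] at hg
        rw [← Nat.card_eq_fintype_card, Nat.card_coe_set_eq, hfix g hg.2 hg.1]
  have hsum' : ∑ ω, (h - f ω) = 2 * h - 2 := by
    have h1 : ∑ ω, (h - f ω) + ∑ ω, f ω = Fintype.card (MulAction.orbitRel.Quotient G Ω) * h := by
      rw [← Finset.sum_add_distrib, Finset.sum_const_nat (m := h), Finset.card_univ]
      intro ω _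
      exact Nat.sub_add_cancel (Nat.le_of_dvd (by omega) (hf ω))
    have h2 : Fintype.card G = 2 * h := by rw [← hh, Nat.card_eq_fintype_card]
    rw [hsum] at h1
    rw [hB2, hh, h2, mul_left_comm] at hB
    change _ = 2 * (Fintype.card (MulAction.orbitRel.Quotient G Ω) * h) at hB
    omega
  have hP0 := hcardG P
  have key := orbit_sizes_of_sum f h hf (by omega) hsum' (Quotient.mk'' P) (by
    change 3 * (MulAction.orbit G P).ncard ≤ h
    nlinarith)
  change (MulAction.orbit G P).ncard = 1 ∨ (MulAction.orbit G P).ncard = 2 ∨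
    h = 12 ∧ (MulAction.orbit G P).ncard = 4 ∨ _ at key
  rw [MulAction.index_stabilizer]
  rcases key with h | h | ⟨h, h'⟩ | h | h
  · exact .inl h
  · exact .inr (.inl h)
  · rw [h', hh] at hP0
    exact .inr (.inr (.inl ⟨by omega, by omega⟩))
  · exact .inr (.inr (.inr (.inl (by omega))))
  · exact .inr (.inr (.inr (.inr (by omega))))

section Action

variable {F K : Type*} [Field F] [Field K] [Algebra F K]

variable (F K) in
/-- Extension of scalars from `SL(2, F)` to `GL(2, K)`. -/
noncomputable def slToGL : SL(2, F) →* GL (Fin 2) K :=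
  (Matrix.SpecialLinearGroup.toGL).comp (Matrix.SpecialLinearGroup.map (algebraMap F K))

theorem slToGL_apply (g : SL(2, F)) (i j : Fin 2) : slToGL F K g i j = algebraMap F K (g i j) :=
  rfl

variable [DecidableEq K]

open OnePoint in
theorem slToGL_smul_infty (g : SL(2, F)) :
    slToGL F K g • (∞ : OnePoint K) = ∞ ↔ g 1 0 = 0 := by
  rw [OnePoint.smul_infty_eq_self_iff, slToGL_apply, map_eq_zero]

theorem slToGL_smul_coe (g : SL(2, F)) (z : K) : slToGL F K g • (z : OnePoint K) = z ↔
    algebraMap F K (g 1 0) * z ^ 2 + (algebraMap F K (g 1 1) - algebraMap F K (g 0 0)) * z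
      - algebraMap F K (g 0 1) = 0 := by
  rw [← Matrix.GeneralLinearGroup.fixpointPolynomial_aeval_eq_zero_iff]
  simp [Matrix.GeneralLinearGroup.fixpointPolynomial, slToGL_apply]

open OnePoint in
theorem ncard_fixed_eq_two {g : SL(2, F)} (h : slTrace g ^ 2 ≠ 4) (h2 : (2 : F) ≠ 0)
    (hs : IsSquare (algebraMap F K (slTrace g ^ 2 - 4))) :
    {P : OnePoint K | slToGL F K g • P = P}.ncard = 2 := by
  have hd := det_entries g
  have ht : slTrace g = g 0 0 + g 1 1 := rfl
  by_cases hc : g 1 0 = 0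
  · have hne : g 1 1 - g 0 0 ≠ 0 := by grind
    have : {P : OnePoint K | slToGL F K g • P = P}
        = {∞, ((algebraMap F K (g 0 1) / algebraMap F K (g 1 1 - g 0 0) : K) : OnePoint K)} := by
      ext P
      have hne' : algebraMap F K (g 1 1 - g 0 0) ≠ 0 := by rwa [Ne, map_eq_zero]
      cases P with
      | infty => simp [slToGL_smul_infty, hc]
      | coe z =>
        simp only [Set.mem_ofPred_eq, slToGL_smul_coe, hc, map_zero, zero_mul, zero_add,
          Set.mem_insert_iff, OnePoint.coe_ne_infty, false_or, Set.mem_singleton_iff,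
          OnePoint.coe_eq_coe]
        rw [eq_div_iff hne', ← map_sub, sub_eq_zero, mul_comm]
    rw [this, Set.ncard_pair (OnePoint.infty_ne_coe _)]
  · obtain ⟨s, hs⟩ := hs
    have hc' : algebraMap F K (g 1 0) ≠ 0 := by rwa [Ne, map_eq_zero]
    have h2' : (2 : K) ≠ 0 := by
      rw [← map_ofNat (algebraMap F K) 2, Ne, map_eq_zero]; exact h2
    have hs0 : s ≠ 0 := by
      rintro rfl
      rw [mul_zero, map_eq_zero] at hs
      exact h (sub_eq_zero.1 hs)
    have hd' := congrArg (algebraMap F K) hd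
    rw [ht] at hs
    simp only [map_sub, map_mul, map_one, map_add, map_pow, map_ofNat] at hs hd'
    generalize hA : algebraMap F K (g 0 0) = a at *
    generalize hB : algebraMap F K (g 0 1) = b at *
    generalize hC : algebraMap F K (g 1 0) = c at *
    generalize hD : algebraMap F K (g 1 1) = d at *
    have : {P : OnePoint K | slToGL F K g • P = P} =
        {(((a - d + s) / (2 * c) : K) : OnePoint K),
          (((a - d - s) / (2 * c) : K) : OnePoint K)} := by
      ext P
      cases P with
      | infty => simp [slToGL_smul_infty, hc]
      | coe z =>
        simp only [Set.mem_ofPred_eq, slToGL_smul_coe, Set.mem_insert_iff, Set.mem_singleton_iff,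
          OnePoint.coe_eq_coe, hA, hB, hC, hD]
        rw [eq_div_iff (by simp [h2', hc']), eq_div_iff (by simp [h2', hc'])]
        have h4 : (z * (2 * c) - (a - d + s)) * (z * (2 * c) - (a - d - s)) =
            4 * c * (c * z ^ 2 + (d - a) * z - b) := by linear_combination hs - 4 * hd'
        have h5 : (4 : K) ≠ 0 := by
          have : (4 : K) = 2 * 2 := by norm_num
          rw [this]; simp [h2']
        constructor
        · intro h6
          rw [h6, mul_zero, mul_eq_zero, sub_eq_zero, sub_eq_zero] at h4
          exact h4
        · intro h6
          have h7 : 4 * c * (c * z ^ 2 + (d - a) * z - b) = 0 := by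
            rw [← h4, mul_eq_zero, sub_eq_zero, sub_eq_zero]; exact h6
          simpa [h5, hc'] using h7
    rw [this, Set.ncard_pair]
    rw [Ne, OnePoint.coe_eq_coe, div_left_inj' (by simp [h2', hc'])]
    grind

theorem IsElliptic.exists_fixed {X : SL(2, F)} (hX : IsElliptic X) (h2 : (2 : F) ≠ 0)
    (hs : IsSquare (algebraMap F K (slTrace X ^ 2 - 4))) :
    ∃ z : K, slToGL F K X • (z : OnePoint K) = z := by
  have h4 : slTrace X ^ 2 ≠ 4 := by
    intro h4
    refine hX (slTrace X / 2) ?_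
    field_simp
    linear_combination (-1) * h4
  have h5 := ncard_fixed_eq_two h4 h2 hs
  obtain ⟨P, hP⟩ := Set.nonempty_of_ncard_ne_zero (h5.trans_ne two_ne_zero)
  cases P with
  | infty => exact (hX.entry_ne_zero (slToGL_smul_infty X |>.1 hP)).elim
  | coe z => exact ⟨z, hP⟩

theorem IsElliptic.commute_of_fixed {X Y : SL(2, F)} (hX : IsElliptic X) {z : K}
    (hz : slToGL F K X • (z : OnePoint K) = z) (hz' : slToGL F K Y • (z : OnePoint K) = z) :
    Y * X = X * Y := by
  rw [slToGL_smul_coe] at hz hz'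
  have hX0 := hX.entry_ne_zero
  have hz0 : ∀ u : F, algebraMap F K u ≠ z := by
    rintro u rfl
    refine hX (X 1 0 * u + X 1 1) ?_
    have h1 : X 1 0 * u ^ 2 + (X 1 1 - X 0 0) * u - X 0 1 = 0 := by
      apply (algebraMap F K).injective
      simpa using hz
    have hd := det_entries X
    have ht : slTrace X = X 0 0 + X 1 1 := rfl
    rw [ht]
    linear_combination X 1 0 * h1 - hd
  have h3 : algebraMap F K (X 1 0 * (Y 1 1 - Y 0 0) - Y 1 0 * (X 1 1 - X 0 0)) * z =
      algebraMap F K (X 1 0 * Y 0 1 - Y 1 0 * X 0 1) := by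
    simp only [map_sub, map_mul]
    linear_combination algebraMap F K (X 1 0) * hz' - algebraMap F K (Y 1 0) * hz
  have h4 : X 1 0 * (Y 1 1 - Y 0 0) - Y 1 0 * (X 1 1 - X 0 0) = 0 := by
    by_contra h
    refine hz0 ((X 1 0 * Y 0 1 - Y 1 0 * X 0 1) /
      (X 1 0 * (Y 1 1 - Y 0 0) - Y 1 0 * (X 1 1 - X 0 0))) ?_
    rw [map_div₀, ← h3, mul_div_cancel_left₀ _ (by rwa [Ne, map_eq_zero])]
  have h5 : X 1 0 * Y 0 1 - Y 1 0 * X 0 1 = 0 := by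
    rw [h4, map_zero, zero_mul, eq_comm, map_eq_zero] at h3
    exact h3
  have h6 : X 0 1 * (Y 1 1 - Y 0 0) = Y 0 1 * (X 1 1 - X 0 0) := by
    apply mul_left_cancel₀ hX0
    linear_combination X 0 1 * h4 - (X 1 1 - X 0 0) * h5
  rw [ext_entries]
  simp only [mul_entries]
  refine ⟨?_, ?_, ?_, ?_⟩
  · linear_combination h5
  · linear_combination -h6
  · linear_combination h4
  · linear_combination -h5

end Action

section Conjugates

variable {F : Type*} [Field F]

local notation "π" => (QuotientGroup.mk : SL(2, F) → PSL(2, F))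

theorem IsElliptic.eq_or_eq_inv {X Y : SL(2, F)} (hX : IsElliptic X) (h : Y * X = X * Y)
    (ht : slTrace Y = slTrace X) (h2 : (2 : F) ≠ 0) : Y = X ∨ Y = X⁻¹ := by
  obtain ⟨h1, h3⟩ := entries_of_commute h
  have hc := hX.entry_ne_zero
  have hd := det_entries X
  have hd' := det_entries Y
  have hX' : slTrace X = X 0 0 + X 1 1 := rfl
  have hY' : slTrace Y = Y 0 0 + Y 1 1 := rfl
  have h4 : slTrace X ^ 2 - 4 ≠ 0 := by
    intro h4
    refine hX (slTrace X / 2) ?_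
    field_simp
    linear_combination (-1) * h4
  obtain ⟨l, hl⟩ : ∃ l, Y 1 0 = l * X 1 0 := ⟨Y 1 0 / X 1 0, by field_simp⟩
  rw [hX', hY'] at ht
  rw [hX'] at h4
  have e1 : Y 0 1 = l * X 0 1 := by apply mul_right_cancel₀ hc; rw [h1, hl]; ring
  have e2 : Y 0 0 - Y 1 1 = l * (X 0 0 - X 1 1) := by
    apply mul_right_cancel₀ hc; rw [h3, hl]; ring
  have e3 : (l - 1) * (l + 1) = 0 := by
    apply mul_right_cancel₀ h4
    have e4 : l ^ 2 * ((X 0 0 - X 1 1) ^ 2 + 4 * (X 0 1 * X 1 0)) =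
        (Y 0 0 - Y 1 1) ^ 2 + 4 * (Y 0 1 * Y 1 0) := by rw [e1, e2, hl]; ring
    have e5 : (Y 0 0 + Y 1 1) ^ 2 = (X 0 0 + X 1 1) ^ 2 := by rw [ht]
    linear_combination e4 + e5 - 4 * hd' + 4 * l ^ 2 * hd
  rw [mul_eq_zero, sub_eq_zero, ← eq_neg_iff_add_eq_zero] at e3
  simp only [ext_entries, inv_entries]
  rcases e3 with rfl | rfl
  · left
    refine ⟨?_, by rw [e1, one_mul], by rw [hl, one_mul], ?_⟩ <;> apply mul_left_cancel₀ h2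
    · linear_combination ht + e2
    · linear_combination ht - e2
  · right
    refine ⟨?_, by rw [e1]; ring, by rw [hl]; ring, ?_⟩ <;> apply mul_left_cancel₀ h2
    · linear_combination ht + e2
    · linear_combination ht - e2

theorem mk_eq_one_of_sq {A : SL(2, F)} (h : A ^ 2 = 1) (h2 : (2 : F) ≠ 0) : π A = 1 := by
  by_contra hA
  have h0 := slTrace_eq_zero_of_sq A hA (by rw [← QuotientGroup.mk_pow, h, QuotientGroup.mk_one])
  have h1 := sq_eq A
  rw [h0] at h1
  rw [pow_two, ext_entries] at h
  have := h.1.symm.trans h1.1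
  simp [one_entries] at this
  grind

theorem card_comap_mk [Finite F] (h2 : (2 : F) ≠ 0) (H : Subgroup PSL(2, F)) :
    Nat.card (H.comap (QuotientGroup.mk' _)) = 2 * Nat.card H := by
  have h1 := Subgroup.card_eq_card_quotient_mul_card_subgroup (Subgroup.center SL(2, F))
  have h3 : Nat.card (Subgroup.center SL(2, F)) = 2 := by
    have : (Subgroup.center SL(2, F) : Set SL(2, F)) = {1, -1} := by
      ext A
      have h4 : A ∈ Subgroup.center SL(2, F) ↔ π A = 1 := (QuotientGroup.eq_one_iff A).symm
      rw [SetLike.mem_coe, h4, mk_eq_one_iff]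
      rfl
    rw [← SetLike.coe_sort_coe, this, Nat.card_coe_set_eq, Set.ncard_pair]
    intro h
    rw [ext_entries] at h
    simp only [neg_entries, one_entries] at h
    grind
  have h4 := Subgroup.index_comap_of_surjective H
    (QuotientGroup.mk'_surjective (Subgroup.center SL(2, F)))
  have h5 := Subgroup.index_mul_card (H.comap (QuotientGroup.mk' (Subgroup.center SL(2, F))))
  have h6 := Subgroup.index_mul_card H
  rw [h3] at h1
  rw [h4, h1, ← h6, mul_assoc] at h5
  rw [mul_comm 2]
  exact Nat.eq_of_mul_eq_mul_left (Nat.pos_of_ne_zero H.index_ne_zero_of_finite) h5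

end Conjugates

section Dichotomy

variable {p : ℕ} [Fact p.Prime]

local notation "π" => (QuotientGroup.mk : SL(2, ZMod p) → PSL(2, ZMod p))

theorem two_ne_zero_of_two_lt (hp2 : 2 < p) : (2 : ZMod p) ≠ 0 := by
  intro h
  have h1 : ((2 : ℕ) : ZMod p) = 0 := by exact_mod_cast h
  rw [ZMod.natCast_eq_zero_iff] at h1
  exact absurd (Nat.le_of_dvd two_pos h1) (by omega)

theorem isSquare_algebraMap_galoisField (hp2 : 2 < p) (a : ZMod p) :
    IsSquare (algebraMap (ZMod p) (GaloisField p 2) a) := by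
  classical
  have := Fintype.ofFinite (GaloisField p 2)
  have hp : p.Prime := Fact.out
  by_cases ha : a = 0
  · rw [ha, map_zero]; exact IsSquare.zero
  have hcard : Fintype.card (GaloisField p 2) = p ^ 2 := by
    rw [← Nat.card_eq_fintype_card, GaloisField.card p 2 two_ne_zero]
  have hchar : ringChar (GaloisField p 2) ≠ 2 := by
    rw [ringChar.eq (GaloisField p 2) p]; omega
  rw [FiniteField.isSquare_iff hchar (by rwa [Ne, map_eq_zero]), hcard, ← map_pow]
  obtain ⟨m, rfl⟩ := hp.odd_of_ne_two (by omega)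
  have : (2 * m + 1) ^ 2 / 2 = (2 * m + 1 - 1) * (m + 1) := by
    rw [Nat.add_sub_cancel]
    refine Nat.div_eq_of_lt_le ?_ ?_
    · ring_nf
      omega
    · ring_nf
      omega
  rw [this, pow_mul, ZMod.pow_card_sub_one_eq_one ha, one_pow, map_one]

theorem mem_invertingSet_or_card {X : SL(2, ZMod p)} {g : PSL(2, ZMod p)} (hp2 : 2 < p)
    (h1 : 2 < orderOf (π X)) (h2 : orderOf (π X) ∣ p + 1)
    (hne : Subgroup.closure {π X, g} ≠ ⊤) :
    g ∈ invertingSet (π X) ∨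
      Nat.card (Subgroup.closure {π X, g}) = 12 ∧ orderOf (π X) = 3 ∨
      Nat.card (Subgroup.closure {π X, g}) = 24 ∨ Nat.card (Subgroup.closure {π X, g}) = 60 := by
  classical
  have hX := isElliptic_of_orderOf h1 h2
  have h20 := two_ne_zero_of_two_lt hp2
  set H := Subgroup.closure {π X, g} with hH
  have hxH : π X ∈ H := Subgroup.subset_closure (by simp)
  have hgH : g ∈ H := Subgroup.subset_closure (by simp)
  set L := H.comap (QuotientGroup.mk' (Subgroup.center SL(2, ZMod p))) with hL
  have hmem : ∀ Y, Y ∈ L ↔ π Y ∈ H := fun Y => Iff.rfl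
  have hLtop : L ≠ ⊤ := by
    intro h
    refine hne (eq_top_iff.2 fun y _ => ?_)
    obtain ⟨Y, rfl⟩ := QuotientGroup.mk_surjective y
    rw [← hmem, h]
    trivial
  have hcard : Nat.card L = 2 * Nat.card H := card_comap_mk h20 H
  have hneg : ∀ Y : SL(2, ZMod p), π (-Y) = π Y := fun Y => (mk_eq_mk_iff _ _).2 (Or.inr rfl)
  have htr : ∀ Y ∈ L, π Y ≠ 1 → slTrace Y ^ 2 ≠ 4 := by
    intro Y hY hY1 h4
    have : (slTrace Y - 2) * (slTrace Y + 2) = 0 := by linear_combination h4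
    rw [mul_eq_zero, sub_eq_zero, ← eq_neg_iff_add_eq_zero] at this
    rcases this with h | h
    · exact hLtop (eq_top_of_parabolic_mem hX hxH hY hY1 h)
    · exact hLtop (eq_top_of_parabolic_mem (U := -Y) hX hxH (by rwa [hmem, hneg])
        (by rwa [hneg]) (by rw [slTrace_neg, h, neg_neg]))
  let K := GaloisField p 2
  obtain ⟨z, hz⟩ := hX.exists_fixed (K := K) h20 (isSquare_algebraMap_galoisField hp2 _)
  let _ : MulAction L (OnePoint K) := MulAction.compHom _ ((slToGL (ZMod p) K).comp L.subtype)
  have hsmul : ∀ (Y : L) (P : OnePoint K), Y • P = slToGL (ZMod p) K (Y : SL(2, ZMod p)) • P :=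
    fun _ _ => rfl
  have : Finite (OnePoint K) := inferInstanceAs (Finite (Option K))
  let c : L := ⟨-1, by rw [hmem, hneg, QuotientGroup.mk_one]; exact H.one_mem⟩
  let XL : L := ⟨X, hxH⟩
  have hne1 : (1 : SL(2, ZMod p)) ≠ -1 := by
    intro h
    rw [ext_entries] at h
    simp only [neg_entries, one_entries] at h
    grind
  have hc1 : c ≠ 1 := fun h => hne1 (congrArg Subtype.val h).symm
  have hc2 : c ^ 2 = 1 := Subtype.ext (by simp [c])
  have hc : ∀ P : OnePoint K, c • P = P := by
    intro P
    rw [hsmul]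
    cases P with
    | infty => rw [slToGL_smul_infty]; simp [c, neg_entries, one_entries]
    | coe z => rw [slToGL_smul_coe]; simp [c, neg_entries, one_entries]
  set S := MulAction.stabilizer L (z : OnePoint K) with hS
  have hXS : XL ∈ S := hz
  have hcS : c ∈ S := hc _
  have hSX : ∀ Y ∈ S, (Y : SL(2, ZMod p)) * X = X * Y := fun Y hY =>
    hX.commute_of_fixed hz hY
  have hpow : ∀ n, Nat.card S ∣ 2 * n → π X ^ n = 1 := by
    intro n hn
    have h3 := (Subgroup.orderOf_dvd_natCard _ hXS).trans hn
    rw [orderOf_dvd_iff_pow_eq_one] at h3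
    have h4 : (X ^ n) ^ 2 = 1 := by
      rw [← pow_mul, mul_comm]; exact congrArg Subtype.val h3
    rw [← QuotientGroup.mk_pow]
    exact mk_eq_one_of_sq h4 h20
  have hS6 : 6 ≤ Nat.card S := by
    have h3 := Subgroup.orderOf_dvd_natCard _ hcS
    rw [orderOf_eq_prime hc2 hc1] at h3
    obtain ⟨k, hk⟩ := h3
    have hk0 : 0 < Nat.card S := Nat.card_pos
    by_contra hlt
    have h4 : Nat.card S ∣ 2 * 2 := by
      have : k = 1 ∨ k = 2 := by omega
      rw [hk]
      rcases this with rfl | rfl <;> decide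
    have h5 := orderOf_dvd_of_pow_eq_one (hpow 2 h4)
    exact absurd (Nat.le_of_dvd two_pos h5) (by omega)
  have key := card_of_two_fixed_points c hc1 hc2 hc (fun Y hY1 hYc => by
    have hY : π (Y : SL(2, ZMod p)) ≠ 1 := by
      rw [Ne, mk_eq_one_iff]
      rintro (h | h)
      · exact hY1 (Subtype.ext h)
      · exact hYc (Subtype.ext h)
    exact ncard_fixed_eq_two (htr Y Y.2 hY) h20 (isSquare_algebraMap_galoisField hp2 _))
    (z : OnePoint K) hS6
  rw [← hS, hcard] at key
  obtain ⟨Y, rfl⟩ := QuotientGroup.mk_surjective g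
  rcases key with h | h | ⟨h, h'⟩ | h | h
  · left; left
    rw [Subgroup.index_eq_one] at h
    rw [← QuotientGroup.mk_mul, hSX ⟨Y, hgH⟩ (by rw [h]; trivial), QuotientGroup.mk_mul]
  · left
    have hn := Subgroup.normal_of_index_eq_two h
    have h3 := hSX _ (hn.conj_mem XL hXS ⟨Y, hgH⟩)
    rcases hX.eq_or_eq_inv h3 (slTrace_conj X Y) h20 with h4 | h4
    · left
      have : Y * X = X * Y := mul_inv_eq_iff_eq_mul.1 h4
      rw [← QuotientGroup.mk_mul, this, QuotientGroup.mk_mul]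
    · right
      have : Y * X = X⁻¹ * Y := mul_inv_eq_iff_eq_mul.1 h4
      rw [← QuotientGroup.mk_mul, this, QuotientGroup.mk_mul, QuotientGroup.mk_inv]
  · refine .inr (.inl ⟨by omega, ?_⟩)
    have h5 := hpow 3 (by rw [h'])
    exact orderOf_eq_prime h5 (by intro h6; rw [h6, orderOf_one] at h1; omega)
  · exact .inr (.inr (.inl (by omega)))
  · exact .inr (.inr (.inr (by omega)))

end Dichotomy

theorem perm_fin_four_dichotomy : ∀ x y : Equiv.Perm (Fin 4), Equiv.Perm.sign x = 1 →
    Equiv.Perm.sign y = 1 → x * x * x = 1 → x ≠ 1 → y * x = x * y ∨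
      ∃ i : Fin 3, (x ^ i.val * y) * (x ^ i.val * y) = 1 ∧ x ^ i.val * y ≠ 1 ∧
        (x * (x ^ i.val * y)) * (x * (x ^ i.val * y)) * (x * (x ^ i.val * y)) = 1 := by
  decide +kernel

theorem mem_invertingSet_or_of_card_eq_twelve {H : Type*} [Group H] (hH : Nat.card H = 12) {x : H}
    (hx : orderOf x = 3) (y : H) : y ∈ invertingSet x ∨
      ∃ i : Fin 3, (x ^ i.val * y) ^ 2 = 1 ∧ x ^ i.val * y ≠ 1 ∧ (x * (x ^ i.val * y)) ^ 3 = 1 := by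
  classical
  have : Finite H := Nat.finite_of_card_ne_zero (by omega)
  set Z := Subgroup.zpowers x with hZ
  have hZc : Nat.card Z = 3 := by rw [hZ, Nat.card_zpowers, hx]
  have hidx : Nat.card (H ⧸ Z) = 4 := by
    have h1 := Subgroup.index_mul_card Z
    rw [hZc, hH] at h1
    change Z.index = 4
    omega
  let e : H ⧸ Z ≃ Fin 4 := Finite.equivFinOfCardEq hidx
  let f : H →* Equiv.Perm (Fin 4) :=
    (e.permCongrHom).toMonoidHom.comp (MulAction.toPermHom H (H ⧸ Z))
  have hker : f.ker = Z.normalCore := by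
    rw [Subgroup.normalCore_eq_ker]
    ext g
    simp [f, MonoidHom.mem_ker]
  have hdvd : Nat.card f.ker ∣ 3 := by
    rw [← hZc, hker]
    exact Subgroup.card_dvd_of_le Z.normalCore_le
  rcases (Nat.dvd_prime Nat.prime_three).1 hdvd with h | h
  · have hinj : Function.Injective f := by
      rw [← MonoidHom.ker_eq_bot_iff]
      exact Subgroup.card_eq_one.1 h
    have hr : f.range = alternatingGroup (Fin 4) := by
      apply Equiv.Perm.eq_alternatingGroup_of_index_eq_two
      have h1 := Subgroup.index_mul_card f.range
      have h2 : Nat.card f.range = 12 := by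
        rw [← hH]; exact (Nat.card_congr (MonoidHom.ofInjective hinj).toEquiv).symm
      have h3 : Nat.card (Equiv.Perm (Fin 4)) = 24 := by
        rw [Nat.card_perm, Nat.card_fin]; rfl
      rw [h2, h3] at h1
      omega
    have hs : ∀ g, Equiv.Perm.sign (f g) = 1 := fun g => by
      rw [← Equiv.Perm.mem_alternatingGroup, ← hr]; exact ⟨g, rfl⟩
    have hx3 : x ^ 3 = 1 := hx ▸ pow_orderOf_eq_one x
    have hx1 : x ≠ 1 := by rintro rfl; rw [orderOf_one] at hx; omega
    rcases perm_fin_four_dichotomy (f x) (f y) (hs x) (hs y)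
      (by rw [← pow_two, ← pow_succ, ← map_pow, hx3, map_one])
      (by rwa [Ne, map_eq_one_iff f hinj]) with h1 | ⟨i, h1, h2, h3⟩
    · left; left
      apply hinj
      rw [map_mul, map_mul, h1]
    · right
      refine ⟨i, ?_, ?_, ?_⟩
      · apply hinj
        rw [pow_two, map_mul, map_mul, map_pow, map_one, h1]
      · rwa [← map_pow, ← map_mul, Ne, map_eq_one_iff f hinj] at h2
      · apply hinj
        rw [pow_succ, pow_two, map_mul, map_mul, map_mul, map_mul, map_pow, map_one, h3]
  · left
    have h2 : Z.normalCore = Z :=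
      Subgroup.eq_of_le_of_card_ge Z.normalCore_le (by rw [← hker, h, hZc])
    have hn : Z.Normal := h2 ▸ Z.normalCore_normal
    have h3 := hn.conj_mem x (Subgroup.mem_zpowers x) y
    rw [hZ, mem_zpowers_iff_mem_range_orderOf, hx] at h3
    simp only [Finset.mem_image, Finset.mem_range] at h3
    obtain ⟨k, hk, h3⟩ := h3
    have hx3 : x ^ 3 = 1 := hx ▸ pow_orderOf_eq_one x
    interval_cases k
    · rw [pow_zero, eq_comm, conj_eq_one_iff] at h3
      rw [h3, orderOf_one] at hx
      omega
    · left
      rw [pow_one, eq_mul_inv_iff_mul_eq] at h3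
      exact h3.symm
    · right
      rw [eq_mul_inv_iff_mul_eq] at h3
      rw [← h3]
      congr 1
      rw [eq_inv_iff_mul_eq_one, ← pow_succ, hx3]

theorem exists_normal_card_four {G : Type*} [Group G] [Finite G] {M : Subgroup G} (hM : IsCoatom M)
    (e : M ≃* alternatingGroup (Fin 4)) (h8 : 8 ∣ Nat.card G) :
    ∃ V : Subgroup G, V.Normal ∧ Nat.card V = 4 ∧ ∀ t ∈ V, t ^ 2 = 1 := by
  have h4 : Nat.card (Fin 4) = 4 := Nat.card_fin 4
  set W : Subgroup M := (alternatingGroup.kleinFour (Fin 4)).map e.symm.toMonoidHom with hW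
  have hWn : W.Normal :=
    (alternatingGroup.normal_kleinFour h4).map _ e.symm.surjective
  have hWc : Nat.card W = 4 := by
    rw [hW, Subgroup.card_map_of_injective e.symm.injective,
      alternatingGroup.kleinFour_card_of_card_eq_four h4]
  set V : Subgroup G := W.map M.subtype with hV
  have hVc : Nat.card V = 4 := by
    rw [hV, Subgroup.card_map_of_injective M.subtype_injective, hWc]
  have hVM : V ≤ M := Subgroup.map_subtype_le W
  have hVs : V.subgroupOf M = W := Subgroup.comap_map_eq_self_of_injective M.subtype_injective W
  have hMN : M ≤ Subgroup.normalizer (V : Set G) := by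
    rw [← Subgroup.normal_subgroupOf_iff_le_normalizer hVM, hVs]
    exact hWn
  have : Fact (Nat.Prime 2) := ⟨Nat.prime_two⟩
  obtain ⟨K, hK, hVK⟩ := Sylow.exists_subgroup_card_pow_succ (p := 2) (n := 2) h8 hVc
  have hKN : K ≤ Subgroup.normalizer (V : Set G) := by
    rw [← Subgroup.normal_subgroupOf_iff_le_normalizer hVK]
    apply Subgroup.normal_of_index_eq_two
    have h1 := Subgroup.index_mul_card (V.subgroupOf K)
    rw [hK, Nat.card_congr (Subgroup.subgroupOfEquivOfLe hVK).toEquiv, hVc] at h1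
    omega
  refine ⟨V, ?_, hVc, ?_⟩
  · rw [← Subgroup.normalizer_eq_top_iff]
    refine (hM.le_iff.1 hMN).resolve_right fun h => ?_
    rw [h] at hKN
    have h1 := Subgroup.card_dvd_of_le hKN
    rw [hK, Nat.card_congr e.toEquiv, alternatingGroup.card_of_card_eq_four h4] at h1
    omega
  · rintro _ ⟨_, ⟨k, hk, rfl⟩, rfl⟩
    have h1 := Monoid.pow_exponent_eq_one (⟨k, hk⟩ : alternatingGroup.kleinFour (Fin 4))
    rw [alternatingGroup.exponent_kleinFour_of_card_eq_four h4] at h1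
    have h2 : k ^ 2 = 1 := congrArg Subtype.val h1
    change (M.subtype (e.symm k)) ^ 2 = 1
    rw [← map_pow, ← map_pow, h2, map_one, map_one]

section SpecialLinear

variable {F : Type*} [Field F]

local notation "π" => (QuotientGroup.mk : SL(2, F) → PSL(2, F))

theorem mk_upperUnip_mul_ne {T : SL(2, F)} {s : F} (hs : s ≠ 0) (h2 : (2 : F) ≠ 0)
    (hT : π T ≠ 1) (hT2 : π T ^ 2 = 1) : π (upperUnip s) * π T ≠ π T * π (upperUnip s) := by
  intro h
  have ht : T 0 0 + T 1 1 = 0 := slTrace_eq_zero_of_sq T hT hT2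
  have hd := det_entries T
  rw [← QuotientGroup.mk_mul, ← QuotientGroup.mk_mul, mk_eq_mk_iff] at h
  simp only [ext_entries, neg_entries, mul_entries, upperUnip_entries] at h
  obtain ⟨h1, h3, h4, h5⟩ | ⟨h1, h3, h4, h5⟩ := h
  · have hc : T 1 0 = 0 := by apply mul_left_cancel₀ hs; linear_combination h1
    have ha : T 0 0 = 0 := by
      apply mul_left_cancel₀ hs
      apply mul_left_cancel₀ h2
      linear_combination s * ht - h3
    rw [hc, ha] at hd
    simp at hd
  · have hc : T 1 0 = 0 := by apply mul_left_cancel₀ h2; linear_combination h4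
    have ha : T 0 0 = 0 := by apply mul_left_cancel₀ h2; linear_combination h1 - s * hc
    rw [hc, ha] at hd
    simp at hd

end SpecialLinear

section Prime

variable {p : ℕ} [Fact p.Prime]

local notation "π" => (QuotientGroup.mk : SL(2, ZMod p) → PSL(2, ZMod p))

theorem not_eight_dvd_card (hp3 : 3 < p) {M : Subgroup PSL(2, ZMod p)} (hM : IsCoatom M)
    (e : M ≃* alternatingGroup (Fin 4)) : ¬ 8 ∣ Nat.card PSL(2, ZMod p) := by
  intro h8
  have h20 := two_ne_zero_of_two_lt (p := p) (by omega)
  obtain ⟨V, hn, hc, ht⟩ := exists_normal_card_four hM e h8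
  obtain ⟨⟨t, htV⟩, ht1⟩ := V.ne_bot_iff_exists_ne_one.1 (by rintro rfl; simp at hc)
  replace ht1 : t ≠ 1 := fun h => ht1 (Subtype.ext h)
  obtain ⟨T, rfl⟩ := QuotientGroup.mk_surjective t
  let f : ZMod p → PSL(2, ZMod p) := fun s => π (upperUnip s) * π T * (π (upperUnip s))⁻¹
  have hfV : ∀ s, f s ∈ (V : Set PSL(2, ZMod p)) \ {1} := fun s =>
    ⟨hn.conj_mem _ htV _, by simpa only [f, Set.mem_singleton_iff, conj_eq_one_iff] using ht1⟩
  have hf : Function.Injective f := by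
    intro r s hrs
    by_contra hne
    refine mk_upperUnip_mul_ne (sub_ne_zero.2 hne) h20 ht1 (ht _ htV) ?_
    have : upperUnip (r - s) = (upperUnip s)⁻¹ * upperUnip r := by
      rw [ext_entries]
      simp only [mul_entries, inv_entries, upperUnip_entries]
      refine ⟨?_, ?_, ?_, ?_⟩ <;> ring
    rw [this, QuotientGroup.mk_mul, QuotientGroup.mk_inv]
    simp only [f] at hrs
    rw [mul_inv_eq_iff_eq_mul] at hrs
    rw [mul_assoc, hrs]
    group
  have h1 : (f '' Set.univ).ncard ≤ ((V : Set PSL(2, ZMod p)) \ {1}).ncard :=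
    Set.ncard_le_ncard (by rintro _ ⟨s, -, rfl⟩; exact hfV s) (Set.toFinite _)
  rw [Set.ncard_image_of_injective _ hf, Set.ncard_univ, Nat.card_zmod,
    Set.ncard_sdiff_singleton_of_mem V.one_mem, ← Nat.card_coe_set_eq, SetLike.coe_sort_coe,
    hc] at h1
  omega

end Prime

theorem perm_fin_four_generators (v w : Equiv.Perm (Fin 4))
    (hv : v = Equiv.swap 0 1 * Equiv.swap 2 3) (hw : w = Equiv.swap 0 1 * Equiv.swap 1 2)
    (a : Fin 2) (u : Equiv.Perm (Fin 4)) (hu : u = w * v ^ a.val) :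
    u * u * u = 1 ∧ u * v * u⁻¹ ≠ v ∧ v * (u * v * u⁻¹) = (u * v * u⁻¹) * v ∧
      u * (u * v * u⁻¹) * u⁻¹ = v * (u * v * u⁻¹) ∧
      ∀ m, Equiv.Perm.sign m = 1 →
        ∃ i j : Fin 2, ∃ k : Fin 3, m = v ^ i.val * (u * v * u⁻¹) ^ j.val * u ^ k.val := by
  subst hu hv hw
  revert a
  decide +kernel

theorem exists_alternatingGroup_fin_four_generators :
    ∃ v w : alternatingGroup (Fin 4), v ≠ 1 ∧ v * v = 1 ∧ ∀ a : Fin 2, ∀ u, u = w * v ^ a.val →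
      u * u * u = 1 ∧ u * v * u⁻¹ ≠ v ∧ v * (u * v * u⁻¹) = (u * v * u⁻¹) * v ∧
      u * (u * v * u⁻¹) * u⁻¹ = v * (u * v * u⁻¹) ∧ ∀ m, m ∈ Subgroup.closure {v, u} := by
  refine ⟨⟨Equiv.swap 0 1 * Equiv.swap 2 3, ?_⟩, ⟨Equiv.swap 0 1 * Equiv.swap 1 2, ?_⟩,
    ?_, ?_, ?_⟩
  · rw [Equiv.Perm.mem_alternatingGroup]; decide
  · rw [Equiv.Perm.mem_alternatingGroup]; decide
  · rw [Ne, ← Subtype.coe_inj]; decide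
  · rw [← Subtype.coe_inj]; decide
  · intro a u hu
    obtain ⟨h1, h2, h3, h4, h5⟩ := perm_fin_four_generators _ _ rfl rfl a u (by rw [hu]; rfl)
    refine ⟨Subtype.ext h1, fun h => h2 (congrArg Subtype.val h), Subtype.ext h3, Subtype.ext h4,
      fun m => ?_⟩
    obtain ⟨i, j, k, h⟩ := h5 m (Equiv.Perm.mem_alternatingGroup.1 m.2)
    generalize hv : (⟨Equiv.swap 0 1 * Equiv.swap 2 3, _⟩ : alternatingGroup (Fin 4)) = v at *
    have h6 : m = v ^ i.val * (u * v * u⁻¹) ^ j.val * u ^ k.val :=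
      Subtype.ext (by rw [h, ← hv]; rfl)
    have hvm : v ∈ Subgroup.closure {v, u} := Subgroup.subset_closure (by simp)
    have hum : u ∈ Subgroup.closure {v, u} := Subgroup.subset_closure (by simp)
    rw [h6]
    exact mul_mem (mul_mem (pow_mem hvm _)
      (pow_mem (mul_mem (mul_mem hum hvm) (inv_mem hum)) _)) (pow_mem hum _)

theorem card_le_sixty {G : Type*} [Group G] [Finite G] {M : Subgroup G} (hM : IsCoatom M)
    (hMc : Nat.card M = 12) {v w g : G} (hv : v ∈ M) (hw : w ∈ M) (hv1 : v ≠ 1) (hv2 : v * v = 1)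
    (hw3 : w * w * w = 1) (hwv : w * (w * v * w⁻¹) * w⁻¹ = v * (w * v * w⁻¹))
    (hgen : M ≤ Subgroup.closure {v, w}) (hg : g ^ 5 = 1) (hvg : v * g * (v * g) = 1)
    (h1 : w * g * (w * g) = 1) (h2 : ∃ m ∈ M, w * g ^ 2 = g * m)
    (h3 : ∃ m ∈ M, w * g ^ 3 = g ^ 3 * m) (h4 : ∃ m ∈ M, w * g ^ 4 = g ^ 2 * m) :
    Nat.card G ≤ 60 := by
  have hgM : g ∉ M := by
    intro hgM
    have e1 := Subgroup.orderOf_dvd_natCard _ hgM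
    have e2 := orderOf_dvd_of_pow_eq_one hg
    rw [hMc] at e1
    have e3 : g = 1 := orderOf_eq_one_iff.1 (Nat.dvd_one.1 (by simpa using Nat.dvd_gcd e1 e2))
    rw [e3, mul_one] at h1
    rw [h1, one_mul] at hw3
    rw [hw3] at hwv
    simp [hv2] at hwv
    exact hv1 hwv
  set S : Set G := {y | ∃ k : ℕ, ∃ m ∈ M, y = g ^ k * m} with hS
  have hgS : ∀ y ∈ S, g * y ∈ S := by
    rintro _ ⟨k, m, hm, rfl⟩
    exact ⟨k + 1, m, hm, by rw [pow_succ', mul_assoc]⟩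
  have hg' : g⁻¹ = g ^ 4 := inv_eq_of_mul_eq_one_right (by rw [← pow_succ', hg])
  have hv' : v⁻¹ = v := inv_eq_of_mul_eq_one_right hv2
  have hw' : w⁻¹ = w * w := inv_eq_of_mul_eq_one_right (by rw [← mul_assoc, hw3])
  have hvS : ∀ y ∈ S, v * y ∈ S := by
    rintro _ ⟨k, m, hm, rfl⟩
    have e1 : SemiconjBy v g (g ^ 4) := by
      change v * g = g ^ 4 * v
      rw [← hg', eq_inv_of_mul_eq_one_left hvg, mul_inv_rev, hv']
    refine ⟨4 * k, v * m, M.mul_mem hv hm, ?_⟩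
    rw [← mul_assoc, (e1.pow_right k).eq, pow_mul, mul_assoc]
  have hwS : ∀ y ∈ S, w * y ∈ S := by
    have e1 : ∃ m ∈ M, w * g = g ^ 4 * m :=
      ⟨w * w, M.mul_mem hw hw, by
        rw [← hg', ← hw', ← mul_inv_rev]
        exact eq_inv_of_mul_eq_one_left h1⟩
    rintro _ ⟨k, m, hm, rfl⟩
    have e2 : ∃ l, ∃ n ∈ M, w * g ^ k = g ^ l * n := by
      rw [pow_eq_pow_mod k hg]
      have : k % 5 < 5 := Nat.mod_lt _ (by norm_num)
      interval_cases k % 5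
      · exact ⟨0, w, hw, by simp⟩
      · exact ⟨4, by simpa using e1⟩
      · exact ⟨1, by simpa using h2⟩
      · exact ⟨3, h3⟩
      · exact ⟨2, h4⟩
    obtain ⟨l, n, hn, e3⟩ := e2
    exact ⟨l, n * m, M.mul_mem hn hm, by rw [← mul_assoc, e3, mul_assoc]⟩
  have htop : Subgroup.closure {v, w, g} = ⊤ := by
    refine hM.2 _ (lt_of_le_of_ne (hgen.trans (Subgroup.closure_mono ?_)) ?_)
    · intro y
      simp only [Set.mem_insert_iff, Set.mem_singleton_iff]
      tauto
    · intro h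
      exact hgM (h ▸ Subgroup.subset_closure (by simp))
  have hall : ∀ y, y ∈ S := by
    intro y
    have hy : y ∈ Subgroup.closure {v, w, g} := htop ▸ trivial
    induction hy using Subgroup.closure_induction_left with
    | one => exact ⟨0, 1, M.one_mem, by simp⟩
    | mul_left x hx y _ ih =>
      rcases hx with rfl | rfl | rfl
      · exact hvS _ ih
      · exact hwS _ ih
      · exact hgS _ ih
    | inv_mul_cancel x hx y _ ih =>
      rcases hx with rfl | rfl | rfl
      · rw [hv']; exact hvS _ ih
      · rw [hw', mul_assoc]; exact hwS _ (hwS _ ih)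
      · rw [hg', pow_succ, pow_succ, pow_succ, pow_one, mul_assoc, mul_assoc, mul_assoc]
        exact hgS _ (hgS _ (hgS _ (hgS _ ih)))
  have hsurj : Function.Surjective fun q : Fin 5 × M => g ^ q.1.val * (q.2 : G) := by
    intro y
    obtain ⟨k, m, hm, rfl⟩ := hall y
    exact ⟨(⟨k % 5, Nat.mod_lt _ (by norm_num)⟩, ⟨m, hm⟩), by simp [← pow_eq_pow_mod k hg]⟩
  have := Nat.card_le_card_of_surjective _ hsurj
  rwa [Nat.card_prod, Nat.card_fin, hMc] at this

section Icosahedral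

open Quaternion

variable {F : Type*} [Field F]

local notation "π" => (QuotientGroup.mk : SL(2, F) → PSL(2, F))

theorem mul_self_of_slTrace_eq_zero {A : SL(2, F)} (h : slTrace A = 0) : A * A = -1 := by
  obtain ⟨h1, h2, h3, h4⟩ := sq_eq A
  rw [ext_entries, h1, h2, h3, h4, h]
  simp only [neg_entries, one_entries]
  simp

/-- Two anticommuting trace-zero elements of `SL(2, F)` span a copy of the quaternions, with the
determinant as norm form. -/
theorem exists_quaternion_hom {I J : SL(2, F)} (hI : slTrace I = 0) (hJ : slTrace J = 0)
    (h : J * I = -(I * J)) :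
    ∃ θ : ℍ[F,-1,0,-1] →ₐ[F] Matrix (Fin 2) (Fin 2) F,
      θ ⟨0, 1, 0, 0⟩ = I ∧ θ ⟨0, 0, 1, 0⟩ = J ∧
      ∀ q, (θ q).det = q.re ^ 2 + q.imI ^ 2 + q.imJ ^ 2 + q.imK ^ 2 := by
  have h1 := congrArg Subtype.val (mul_self_of_slTrace_eq_zero hI)
  have h2 := congrArg Subtype.val (mul_self_of_slTrace_eq_zero hJ)
  have h3 := congrArg Subtype.val h
  simp only [Matrix.SpecialLinearGroup.coe_mul, Matrix.SpecialLinearGroup.coe_neg,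
    Matrix.SpecialLinearGroup.coe_one] at h1 h2 h3
  refine ⟨QuaternionAlgebra.Basis.liftHom ⟨I, J, I * J, ?_, ?_, rfl, ?_⟩, ?_, ?_, fun q => ?_⟩
  · simp [h1]
  · simp [h2]
  · simp [h3]
  · simp [QuaternionAlgebra.Basis.lift]
  · simp [QuaternionAlgebra.Basis.lift]
  · have e1 := det_entries I
    have e2 := det_entries J
    have e3 := (ext_entries.1 h).1
    simp only [neg_entries, mul_entries] at e3
    have hI' : I 1 1 = -I 0 0 := by rw [slTrace] at hI; linear_combination hI
    have hJ' : J 1 1 = -J 0 0 := by rw [slTrace] at hJ; linear_combination hJ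
    rw [hI'] at e1
    rw [hJ'] at e2
    rw [Matrix.det_fin_two]
    simp only [QuaternionAlgebra.Basis.liftHom_apply, QuaternionAlgebra.Basis.lift,
      Matrix.algebraMap_eq_diagonal, Matrix.add_apply, Matrix.smul_apply, Matrix.mul_apply,
      Fin.sum_univ_two, hI', hJ', smul_eq_mul]
    simp
    linear_combination q.imI ^ 2 * e1 + q.imJ ^ 2 * e2 +
      q.imK ^ 2 * ((J 0 0 * -J 0 0 - J 0 1 * J 1 0) * e1 + e2) +
      (q.re * q.imK - q.imI * q.imJ) * e3

theorem exists_icosahedral_quaternion (h2 : (2 : F) ≠ 0) {φ : F} (hφ : φ ^ 2 = φ + 1) :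
    ∃ i j w g : ℍ[F,-1,0,-1], i = ⟨0, 1, 0, 0⟩ ∧ j = ⟨0, 0, 1, 0⟩ ∧
      w.re ^ 2 + w.imI ^ 2 + w.imJ ^ 2 + w.imK ^ 2 = 1 ∧
      g.re ^ 2 + g.imI ^ 2 + g.imJ ^ 2 + g.imK ^ 2 = 1 ∧
      w * i = j * w ∧ w * j = i * j * w ∧ g ^ 5 = -1 ∧ i * g * (i * g) = -1 ∧
      w * g * (w * g) = -1 ∧ w * g ^ 2 = g * (i * j) ∧ w * g ^ 3 = -(g ^ 3 * (j * w ^ 2)) ∧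
      w * g ^ 4 = g ^ 2 * (i * j * w) := by
  obtain ⟨t, ht⟩ : ∃ t : F, t * 2 = 1 := ⟨2⁻¹, inv_mul_cancel₀ h2⟩
  obtain ⟨g, hg⟩ : ∃ g : ℍ[F,-1,0,-1], g = ⟨φ * t, 0, (φ - 1) * t, t⟩ := ⟨_, rfl⟩
  obtain ⟨w, hw⟩ : ∃ w : ℍ[F,-1,0,-1], w = ⟨t, t, t, t⟩ := ⟨_, rfl⟩
  have g2 : g ^ 2 = ⟨(φ - 1) * t, 0, t, φ * t⟩ := by
    rw [pow_two, hg, QuaternionAlgebra.mk_mul_mk]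
    ext <;> simp only <;> grind
  have g3 : g ^ 3 = ⟨(1 - φ) * t, 0, t, φ * t⟩ := by
    rw [pow_succ, g2, hg, QuaternionAlgebra.mk_mul_mk]
    ext <;> simp only <;> grind
  have g4 : g ^ 4 = ⟨-φ * t, 0, (φ - 1) * t, t⟩ := by
    rw [pow_succ, g3, hg, QuaternionAlgebra.mk_mul_mk]
    ext <;> simp only <;> grind
  have g5 : g ^ 5 = -1 := by
    rw [pow_succ, g4, hg, QuaternionAlgebra.mk_mul_mk]
    ext <;> simp <;> grind
  have w2 : w ^ 2 = ⟨-t, t, t, t⟩ := by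
    rw [pow_two, hw, QuaternionAlgebra.mk_mul_mk]
    ext <;> simp only <;> grind
  refine ⟨_, _, w, g, rfl, rfl, ?_, ?_, ?_, ?_, g5, ?_, ?_, ?_, ?_, ?_⟩
  · rw [hw]
    grind
  · rw [hg]
    grind
  all_goals
    try rw [g2]
    try rw [g3]
    try rw [g4]
    try rw [w2]
    try rw [hw]
    try rw [hg]
    clear hw hg g2 g3 g4 g5 w2
    simp only [QuaternionAlgebra.mk_mul_mk, QuaternionAlgebra.neg_mk]
    ext <;> simp only [QuaternionAlgebra.re_neg, QuaternionAlgebra.imI_neg,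
      QuaternionAlgebra.imJ_neg, QuaternionAlgebra.imK_neg, QuaternionAlgebra.re_one,
      QuaternionAlgebra.imI_one, QuaternionAlgebra.imJ_one, QuaternionAlgebra.imK_one] <;> grind

theorem exists_icosahedral_generators (h2 : (2 : F) ≠ 0) {φ : F} (hφ : φ ^ 2 = φ + 1)
    {I J : SL(2, F)} (hI : slTrace I = 0) (hJ : slTrace J = 0) (h : J * I = -(I * J)) :
    ∃ W G : SL(2, F), W * I = J * W ∧ W * J = I * J * W ∧ G ^ 5 = -1 ∧ I * G * (I * G) = -1 ∧
      W * G * (W * G) = -1 ∧ W * G ^ 2 = G * (I * J) ∧ W * G ^ 3 = -(G ^ 3 * (J * W ^ 2)) ∧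
      W * G ^ 4 = G ^ 2 * (I * J * W) := by
  obtain ⟨θ, hi, hj, hdet⟩ := exists_quaternion_hom hI hJ h
  obtain ⟨i, j, w, g, rfl, rfl, hw, hg, h1, h2, h3, h4, h5, h6, h7, h8⟩ :=
    exists_icosahedral_quaternion h2 hφ
  obtain ⟨W, hW⟩ : ∃ W : SL(2, F), θ w = W := ⟨⟨θ w, by rw [hdet, hw]⟩, rfl⟩
  obtain ⟨G, hG⟩ : ∃ G : SL(2, F), θ g = G := ⟨⟨θ g, by rw [hdet, hg]⟩, rfl⟩
  refine ⟨W, G, Subtype.ext ?_, Subtype.ext ?_, Subtype.ext ?_, Subtype.ext ?_, Subtype.ext ?_,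
    Subtype.ext ?_, Subtype.ext ?_, Subtype.ext ?_⟩
  · simpa [-QuaternionAlgebra.mk_mul_mk, hi, hj, hW, hG] using congrArg θ h1
  · simpa [-QuaternionAlgebra.mk_mul_mk, hi, hj, hW, hG] using congrArg θ h2
  · simpa [-QuaternionAlgebra.mk_mul_mk, hi, hj, hW, hG] using congrArg θ h3
  · simpa [-QuaternionAlgebra.mk_mul_mk, hi, hj, hW, hG] using congrArg θ h4
  · simpa [-QuaternionAlgebra.mk_mul_mk, hi, hj, hW, hG] using congrArg θ h5
  · simpa [-QuaternionAlgebra.mk_mul_mk, hi, hj, hW, hG] using congrArg θ h6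
  · simpa [-QuaternionAlgebra.mk_mul_mk, hi, hj, hW, hG] using congrArg θ h7
  · simpa [-QuaternionAlgebra.mk_mul_mk, hi, hj, hW, hG] using congrArg θ h8

/-- An element commuting with two noncommuting trace-zero elements is central. -/
theorem mk_eq_one_of_commute {I J A : SL(2, F)} (hI : slTrace I = 0) (hJ : slTrace J = 0)
    (h : I * J ≠ J * I) (hAI : A * I = I * A) (hAJ : A * J = J * A) : π A = 1 := by
  have hI' : I 1 1 = -I 0 0 := by rw [slTrace] at hI; linear_combination hI
  have hJ' : J 1 1 = -J 0 0 := by rw [slTrace] at hJ; linear_combination hJ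
  rw [mk_eq_one_iff_entries]
  rw [Ne, ext_entries] at h
  rw [ext_entries] at hAI hAJ
  simp only [mul_entries, hI', hJ'] at h hAI hAJ
  grind

theorem anticommute_of_mk_commute {I J : SL(2, F)} (h2 : (2 : F) ≠ 0) (hI : slTrace I = 0)
    (hJ : slTrace J = 0) (hne : π I ≠ π J) (h : π I * π J = π J * π I) :
    J * I = -(I * J) ∧ I * J ≠ J * I := by
  have hII := mul_self_of_slTrace_eq_zero hI
  have hJJ := mul_self_of_slTrace_eq_zero hJ
  have h1 : I * J ≠ J * I := by
    intro h1
    have h3 : (I * J) ^ 2 = 1 := by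
      rw [pow_two, mul_assoc, ← mul_assoc J, ← h1, mul_assoc, hJJ, ← mul_assoc, hII]
      simp
    have h4 : π (I * J) = 1 := mk_eq_one_of_sq h3 h2
    have h5 : π I * π I = 1 := by
      rw [← QuotientGroup.mk_mul, hII, mk_eq_one_iff]
      exact Or.inr rfl
    exact hne (mul_left_cancel (h5.trans h4.symm))
  refine ⟨?_, h1⟩
  have h3 : π (J * I) = π (I * J) := h.symm
  exact ((mk_eq_mk_iff _ _).1 h3).resolve_left (Ne.symm h1)

theorem card_le_sixty_of_golden [Finite F] (h2 : (2 : F) ≠ 0) {φ : F} (hφ : φ ^ 2 = φ + 1)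
    {M : Subgroup PSL(2, F)} (hM : IsCoatom M) (e : M ≃* alternatingGroup (Fin 4)) :
    Nat.card PSL(2, F) ≤ 60 := by
  obtain ⟨v, w, hv1, hv2, H⟩ := exists_alternatingGroup_fin_four_generators
  obtain ⟨ψ, hψ⟩ : ∃ ψ : alternatingGroup (Fin 4) →* PSL(2, F),
    ψ = M.subtype.comp e.symm.toMonoidHom := ⟨_, rfl⟩
  have hinj : Function.Injective ψ := by
    rw [hψ]
    exact M.subtype_injective.comp e.symm.injective
  have hmem : ∀ a, ψ a ∈ M := by
    intro a
    rw [hψ]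
    exact (e.symm a).2
  have hrange : ∀ m ∈ M, ∃ a, ψ a = m := by
    intro m hm
    exact ⟨e ⟨m, hm⟩, by rw [hψ]; simp⟩
  obtain ⟨I, hIv⟩ := QuotientGroup.mk_surjective (ψ v)
  obtain ⟨W, hWw⟩ := QuotientGroup.mk_surjective (ψ w)
  obtain ⟨J, hJ⟩ : ∃ J, J = W * I * W⁻¹ := ⟨_, rfl⟩
  have hJW : J * W = W * I := by rw [hJ, inv_mul_cancel_right]
  have hIt : slTrace I = 0 := by
    apply slTrace_eq_zero_of_sq
    · rw [hIv, Ne, map_eq_one_iff ψ hinj]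
      exact hv1
    · rw [hIv, pow_two, ← map_mul, hv2, map_one]
  have hJt : slTrace J = 0 := by rw [hJ, slTrace_conj, hIt]
  obtain ⟨-, a2, a3, a4, -⟩ := H 0 w (by simp)
  have hJv : π J = ψ (w * v * w⁻¹) := by
    rw [hJ, map_mul, map_mul, map_inv, ← hIv, ← hWw]
    rfl
  obtain ⟨hanti, hnc⟩ := anticommute_of_mk_commute h2 hIt hJt
    (by rw [hIv, hJv]; exact fun h => a2 (hinj h).symm)
    (by rw [hIv, hJv, ← map_mul, ← map_mul, a3])
  obtain ⟨a, W', hW', hI', hJ'⟩ : ∃ a : Fin 2, ∃ W' : SL(2, F), π W' = ψ (w * v ^ a.val) ∧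
      W' * I = J * W' ∧ W' * J = I * J * W' := by
    have h3 : π (W * J * W⁻¹) = π (I * J) := by
      have : π (W * J * W⁻¹) = π W * π J * (π W)⁻¹ := rfl
      rw [this, hWw, hJv, ← map_mul, ← map_inv, ← map_mul, a4, map_mul, ← hIv, ← hJv]
      rfl
    rcases (mk_eq_mk_iff _ _).1 h3 with h4 | h4
    · exact ⟨0, W, by simpa using hWw, hJW.symm, mul_inv_eq_iff_eq_mul.1 h4⟩
    · refine ⟨1, W * I, ?_, ?_, ?_⟩
      · rw [map_mul, Fin.val_one, pow_one, ← hIv, ← hWw]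
        rfl
      · rw [← mul_assoc, hJW]
      · have h5 : I * J = -(J * I) := by rw [hanti, neg_neg]
        have h6 := mul_inv_eq_iff_eq_mul.1 h4
        calc W * I * J = W * -(J * I) := by rw [mul_assoc, h5]
          _ = -(W * J * I) := by rw [mul_neg, mul_assoc]
          _ = I * J * (W * I) := by rw [h6, neg_mul, neg_mul, neg_neg, mul_assoc]
  obtain ⟨W₀, G, b1, b2, b3, b4, b5, b6, b7, b8⟩ :=
    exists_icosahedral_generators h2 hφ hIt hJt hanti
  have hW₀ : π W₀ = ψ (w * v ^ a.val) := by
    rw [← hW']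
    refine (inv_mul_eq_one (G := PSL(2, F))).1
      (mk_eq_one_of_commute (A := W₀⁻¹ * W') hIt hJt hnc ?_ ?_)
    · rw [mul_assoc, hI', inv_mul_eq_iff_eq_mul, ← mul_assoc W₀, b1]
      simp [mul_assoc]
    · rw [mul_assoc, hJ', inv_mul_eq_iff_eq_mul, ← mul_assoc W₀, b2]
      simp [mul_assoc]
  obtain ⟨c1, c2, c3, c4, c5⟩ := H a _ rfl
  generalize w * v ^ a.val = u at *
  have hmI : π I ∈ M := hIv ▸ hmem v
  have hmW : π W₀ ∈ M := hW₀ ▸ hmem u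
  have hmJ : π J ∈ M := hJv ▸ hmem _
  have hsign : ∀ {A B : SL(2, F)}, A = -B → π A = π B := fun h => (mk_eq_mk_iff _ _).2 (Or.inr h)
  refine card_le_sixty hM ?_ (v := π I) (w := π W₀) (g := π G) hmI hmW ?_ ?_ ?_ ?_ ?_ ?_ ?_ ?_
    ⟨π (I * J), M.mul_mem hmI hmJ, congrArg π b6⟩
    ⟨π (J * W₀ ^ 2), M.mul_mem hmJ (M.pow_mem hmW 2), hsign b7⟩
    ⟨π (I * J * W₀), M.mul_mem (M.mul_mem hmI hmJ) hmW, congrArg π b8⟩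
  · rw [Nat.card_congr e.toEquiv, alternatingGroup.card_of_card_eq_four (Nat.card_fin 4)]
  · rw [hIv, Ne, map_eq_one_iff ψ hinj]
    exact hv1
  · rw [hIv, ← map_mul, hv2, map_one]
  · rw [hW₀, ← map_mul, ← map_mul, c1, map_one]
  · rw [hIv, hW₀]
    simp only [← map_mul, ← map_inv, c4]
  · intro m hm
    obtain ⟨a, rfl⟩ := hrange m hm
    have := Subgroup.mem_map_of_mem ψ (c5 a)
    rwa [MonoidHom.map_closure, Set.image_pair, ← hIv, ← hW₀] at this
  · exact hsign b3
  · exact hsign b4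
  · exact hsign b5

end Icosahedral

theorem three_lt_of_two_lt_orderOf {p : ℕ} [Fact p.Prime] (hp2 : 2 < p) {X : SL(2, ZMod p)}
    (h1 : 2 < orderOf (QuotientGroup.mk X : PSL(2, ZMod p)))
    (h2 : orderOf (QuotientGroup.mk X : PSL(2, ZMod p)) ∣ p + 1) : 3 < p := by
  by_contra hp
  obtain rfl : p = 3 := by omega
  have h3 : slTrace X ^ 2 = 1 := ZMod.pow_card_sub_one_eq_one
    (slTrace_ne_zero_of_sq_ne_one (pow_ne_one_of_lt_orderOf (by norm_num) h1))
  have h4 : (QuotientGroup.mk X : PSL(2, ZMod 3)) ^ 3 = 1 := by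
    rw [← QuotientGroup.mk_pow, mk_eq_one_iff_entries, pow_succ, pow_two]
    obtain ⟨a, b, c, d⟩ := sq_eq X
    simp only [(mul_entries (X * X) X).1, (mul_entries (X * X) X).2.1,
      (mul_entries (X * X) X).2.2.1, (mul_entries (X * X) X).2.2.2, a, b, c, d]
    rw [slTrace] at h3 ⊢
    refine ⟨?_, ?_, ?_⟩
    · linear_combination X 0 1 * h3
    · linear_combination X 1 0 * h3
    · linear_combination (X 0 0 - X 1 1) * h3
  have h5 := Nat.dvd_gcd (orderOf_dvd_of_pow_eq_one h4) h2
  have h6 := Nat.le_of_dvd (by norm_num) h5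
  norm_num at h6
  omega

theorem card_ne_sixty {p : ℕ} [Fact p.Prime] (hp2 : 2 < p) {M : Subgroup PSL(2, ZMod p)}
    (hM : IsCoatom M) (e : M ≃* alternatingGroup (Fin 4)) {H : Subgroup PSL(2, ZMod p)}
    (hH : H ≠ ⊤) : Nat.card H ≠ 60 := by
  intro hc
  have : Fact (Nat.Prime 5) := ⟨by norm_num⟩
  obtain ⟨y, hy⟩ := exists_prime_orderOf_dvd_card' (G := H) 5 (by rw [hc]; norm_num)
  obtain ⟨Y, hY⟩ := QuotientGroup.mk_surjective (y : PSL(2, ZMod p))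
  rw [← Subgroup.orderOf_coe, ← hY] at hy
  obtain ⟨φ, hφ⟩ := exists_golden_of_pow_five Y
    (by rw [Ne, ← orderOf_eq_one_iff, hy]; norm_num) (by rw [← hy, pow_orderOf_eq_one])
  have hG := card_le_sixty_of_golden (two_ne_zero_of_two_lt hp2) hφ hM e
  exact hH (Subgroup.eq_top_of_le_card H (by rwa [hc]))

theorem coclique_bound_main3a (p : ℕ) (hp : p.Prime) (hp2 : 2 < p)
    (A : Set PSL(2, ZMod p)) (hA : IsMaximalCoclique A)
    (hnotmax : ∀ M : Subgroup PSL(2, ZMod p), IsCoatom M → A ≠ (M : Set PSL(2, ZMod p)))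
    (x : PSL(2, ZMod p)) (hxA : x ∈ A) (hx2 : 2 < orderOf x)
    (hxdvd : orderOf x ∣ p + 1)
    (hA4 : HasMaximalSubgroupIsoTo PSL(2, ZMod p) (alternatingGroup (Fin 4))) :
    2 * A.ncard ≤ 9 * (p + 1) + 2 := by
  have : Fact p.Prime := ⟨hp⟩
  obtain ⟨M, hM, ⟨e⟩⟩ := hA4
  obtain ⟨X, rfl⟩ := QuotientGroup.mk_surjective x
  have hp3 := three_lt_of_two_lt_orderOf hp2 hx2 hxdvd
  have h8 := not_eight_dvd_card hp3 hM e
  have hX := isElliptic_of_orderOf hx2 hxdvd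
  have hX2 : (QuotientGroup.mk X : PSL(2, ZMod p)) ^ 2 ≠ 1 :=
    pow_ne_one_of_lt_orderOf (by norm_num) hx2
  generalize hx : (QuotientGroup.mk X : PSL(2, ZMod p)) = x at *
  set T : Set PSL(2, ZMod p) := {t | t ^ 2 = 1 ∧ t ≠ 1 ∧ (x * t) ^ 3 = 1} with hT
  have hT' : T.ncard ≤ p + 2 := by
    simpa [hx] using ncard_mk_cube_le hX (by rwa [hx])
  have hI : (invertingSet x).ncard ≤ p + 1 := by
    have := hX.ncard_invertingSet_mk_le (by rwa [hx])
      (two_ne_zero_of_two_lt hp2) (by simpa using hp.odd_of_ne_two (by omega))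
    simpa [hx] using this
  have hsub : A ⊆ invertingSet x ∪ ⋃ i : Fin 3, (fun t => (x ^ i.val)⁻¹ * t) '' T := by
    intro g hg
    have hne := hA.1 x hxA g hg
    rcases mem_invertingSet_or_card hp2 (by rwa [hx]) (by rwa [hx]) (hx ▸ hne) with
      h | ⟨h, h3⟩ | h | h
    · exact Or.inl (hx ▸ h)
    · rw [hx] at h h3
      have hxm : x ∈ Subgroup.closure {x, g} := Subgroup.subset_closure (by simp)
      have hgm : g ∈ Subgroup.closure {x, g} := Subgroup.subset_closure (by simp)
      rcases mem_invertingSet_or_of_card_eq_twelve h (x := ⟨x, hxm⟩)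
        (by rwa [← Subgroup.orderOf_coe]) ⟨g, hgm⟩ with h4 | ⟨i, h4, h5, h6⟩
      · left
        rcases h4 with h4 | h4
        · exact Or.inl (congrArg Subtype.val h4)
        · exact Or.inr (congrArg Subtype.val h4)
      · right
        refine Set.mem_iUnion.2 ⟨i, x ^ i.val * g, ⟨congrArg Subtype.val h4, fun h7 => h5 ?_,
          congrArg Subtype.val h6⟩, by simp⟩
        exact Subtype.ext h7
    · rw [hx] at h
      exact absurd ((by rw [h]; norm_num : 8 ∣ Nat.card (Subgroup.closure {x, g})).trans
        (Subgroup.card_subgroup_dvd_card _)) h8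
    · rw [hx] at h
      exact absurd h (card_ne_sixty hp2 hM e hne)
  have hU : (⋃ i : Fin 3, (fun t => (x ^ i.val)⁻¹ * t) '' T).ncard ≤ 3 * (p + 2) := by
    refine (Set.ncard_iUnion_le_of_fintype _).trans ?_
    refine (Finset.sum_le_card_nsmul _ _ (p + 2) fun i _ =>
      (Set.ncard_image_le (Set.toFinite _)).trans hT').trans ?_
    simp
  have h9 := ((Set.ncard_le_ncard hsub (Set.toFinite _)).trans (Set.ncard_union_le _ _)).trans
    (add_le_add hI hU)
  omega
end

section
/- Let p > 2 be a prime, G = PSL₂(p), and let A ⊆ G be a maximal coclique which is not the underlying set of a maximal subgroup of G. Suppose A contains an element x of order greater than 2 whose order divides p + 1. If G contains both A₅ and S₄ as maximal subgroups, then |A| ≤ (93/2)(p + 1), i.e. 2·|A| ≤ 93(p + 1). -/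
open scoped MatrixGroups

theorem card_stabilizers_le_five {N m₀ n₀ m₁ n₁ m₂ n₂ : ℕ} (h₀ : m₀ * n₀ = N)
    (h₁ : m₁ * n₁ = N) (h₂ : m₂ * n₂ = N) (hn₁ : 2 ≤ n₁) (hn₂ : 2 ≤ n₂)
    (hsum : m₀ + m₁ + m₂ = N + 2) (hn₀ : 3 ≤ n₀) (hm₀ : 3 ≤ m₀) :
    n₀ ≤ 5 ∧ n₁ ≤ 5 ∧ n₂ ≤ 5 := by
  have key : ∀ {m n m' n' : ℕ}, m * n = N → m' * n' = N → n = 2 → 2 ≤ n' →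
      m₀ + m + m' = N + 2 → n₀ ≤ 5 ∧ n ≤ 5 ∧ n' ≤ 5 := by
    intro m n m' n' h h' hn hn' hs
    subst hn
    have hn3 : 3 ≤ n' := by
      by_contra hlt
      obtain rfl : n' = 2 := by omega
      omega
    refine ⟨?_, by omega, ?_⟩
    · have : m' * 3 ≤ N := h' ▸ Nat.mul_le_mul_left _ hn3
      by_contra hlt
      have : m₀ * 6 ≤ N := h₀ ▸ Nat.mul_le_mul_left _ (by omega)
      omega
    · have : m₀ * 3 ≤ N := h₀ ▸ Nat.mul_le_mul_left _ hn₀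
      by_contra hlt
      have : m' * 6 ≤ N := h' ▸ Nat.mul_le_mul_left _ (by omega)
      omega
  by_cases h : n₁ = 2
  · exact key h₁ h₂ h hn₂ hsum
  by_cases h' : n₂ = 2
  · obtain ⟨h1, h2, h3⟩ := key h₂ h₁ h' hn₁ (by omega)
    exact ⟨h1, h3, h2⟩
  have a0 : m₀ * 3 ≤ N := h₀ ▸ Nat.mul_le_mul_left _ hn₀
  have a1 : m₁ * 3 ≤ N := h₁ ▸ Nat.mul_le_mul_left _ (by omega)
  have a2 : m₂ * 3 ≤ N := h₂ ▸ Nat.mul_le_mul_left _ (by omega)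
  omega

theorem card_orbit_le_two_or_card_stabilizer_le_five {ι : Type*} [Fintype ι] {N : ℕ}
    (m n : ι → ℕ) (hmn : ∀ i, m i * n i = N) (hn : ∀ i, 2 ≤ n i)
    (hsum : ∑ i, m i + 2 * (N - 1) = Fintype.card ι * N) (i₀ : ι) (hn₀ : 3 ≤ n i₀) :
    m i₀ ≤ 2 ∨ ∀ i, n i ≤ 5 := by
  classical
  rcases Nat.eq_zero_or_pos N with rfl | hN
  · left
    have := hmn i₀
    rcases Nat.mul_eq_zero.1 this with h | h <;> omega
  have hm1 : ∀ i, 1 ≤ m i := fun i ↦ by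
    rcases Nat.eq_zero_or_pos (m i) with h | h
    · have := hmn i
      simp [h] at this
      omega
    · exact h
  have hm2 : ∀ i, m i * 2 ≤ N := fun i ↦ hmn i ▸ Nat.mul_le_mul_left _ (hn i)
  have hm3 : m i₀ * 3 ≤ N := hmn i₀ ▸ Nat.mul_le_mul_left _ hn₀
  have hk : Fintype.card ι < 4 := by
    by_contra hk
    have h1 : (∑ i, m i) * 2 ≤ Fintype.card ι * N := by
      rw [Finset.sum_mul]
      simpa using Finset.sum_le_card_nsmul Finset.univ (fun i ↦ m i * 2) N fun i _ ↦ hm2 i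
    have h2 : 4 * N ≤ Fintype.card ι * N := Nat.mul_le_mul_right _ (by omega)
    omega
  have e := Fintype.equivFin ι
  generalize hc : Fintype.card ι = k at *
  rw [← e.symm.sum_comp] at hsum
  obtain ⟨j, rfl⟩ := e.symm.surjective i₀
  rw [← e.symm.forall_congr_right (q := fun i ↦ n i ≤ 5)]
  by_cases hle : m (e.symm j) ≤ 2
  · exact Or.inl hle
  right
  interval_cases k
  · exact j.elim0
  · obtain rfl := Subsingleton.elim j 0
    simp at hsum
    omega
  · rw [Fin.sum_univ_two] at hsum
    have := hm1 (e.symm 0)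
    have := hm1 (e.symm 1)
    fin_cases j <;> simp at hle <;> omega
  · rw [Fin.sum_univ_three] at hsum
    have key := fun {a b c : Fin 3} (h : m (e.symm a) + m (e.symm b) + m (e.symm c) = N + 2) ↦
      card_stabilizers_le_five (hmn (e.symm a)) (hmn (e.symm b)) (hmn (e.symm c)) (hn _) (hn _) h
    rw [Fin.forall_fin_succ, Fin.forall_fin_two]
    simp only [Fin.succ_zero_eq_one, Fin.succ_one_eq_two]
    fin_cases j <;> simp at hle hn₀
    · exact key (by omega) hn₀ (by omega)
    · obtain ⟨h1, h2, h3⟩ := key (a := 1) (b := 0) (c := 2) (by omega) hn₀ (by omega)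
      exact ⟨h2, h1, h3⟩
    · obtain ⟨h1, h2, h3⟩ := key (a := 2) (b := 0) (c := 1) (by omega) hn₀ (by omega)
      exact ⟨h2, h3, h1⟩

open MulAction in
/-- The class equation for a finite group acting so that each nontrivial element has exactly two
fixed points. -/
theorem sum_card_orbit_add {Q α : Type*} [Group Q] [Finite Q] [MulAction Q α] [Finite α]
    [Fintype (orbitRel.Quotient Q α)]
    (h2 : ∀ q : Q, q ≠ 1 → (fixedBy α q).ncard = 2) :
    ∑ ω : orbitRel.Quotient Q α, ω.orbit.ncard + 2 * (Nat.card Q - 1) =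
      Fintype.card (orbitRel.Quotient Q α) * Nat.card Q := by
  classical
  have := Fintype.ofFinite Q
  have := Fintype.ofFinite α
  have burnside := sum_card_fixedBy_eq_card_orbits_mul_card_group Q α
  rw [← Finset.add_sum_erase _ _ (Finset.mem_univ (1 : Q)),
    Finset.sum_congr rfl (g := fun _ ↦ 2)] at burnside
  · rw [Nat.card_eq_fintype_card]
    convert burnside using 2
    · simp only [← Nat.card_eq_fintype_card, fixedBy_one_eq_univ, Nat.card_univ]
      rw [Nat.card_congr (selfEquivSigmaOrbits' Q α), Nat.card_sigma]
      rfl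
    · simp [mul_comm]
  · intro q hq
    rw [← Nat.card_eq_fintype_card]
    exact h2 q (Finset.ne_of_mem_erase hq)

open MulAction in
theorem orbit_fixed_or_pow_eq_one_of_finite {Q α : Type*} [Group Q] [Finite Q] [MulAction Q α]
    [Finite α] (h2 : ∀ q : Q, q ≠ 1 → (fixedBy α q).ncard = 2)
    (hstab : ∀ s : α, ∃ q : Q, q ≠ 1 ∧ q • s = s)
    {x : Q} (hx : x ^ 2 ≠ 1) {a : α} (ha : x • a = a) :
    (∀ y : Q, x • y • a = y • a) ∨ ∀ q : Q, ∃ n, 2 ≤ n ∧ n ≤ 5 ∧ q ^ n = 1 := by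
  classical
  have := Fintype.ofFinite (orbitRel.Quotient Q α)
  have hcard : ∀ s : α, (orbit Q s).ncard * Nat.card (stabilizer Q s) = Nat.card Q := fun s ↦ by
    rw [← Nat.card_coe_set_eq, ← Nat.card_prod]
    exact Nat.card_congr (orbitProdStabilizerEquivGroup Q s)
  have hn : ∀ s : α, 2 ≤ Nat.card (stabilizer Q s) := fun s ↦ by
    obtain ⟨q, hq, hqs⟩ := hstab s
    have : Nontrivial (stabilizer Q s) := ⟨⟨q, hqs⟩, 1, fun h ↦ hq (congrArg Subtype.val h)⟩
    exact Finite.one_lt_card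
  have horb : ∀ s : α, (orbitRel.Quotient.orbit (Quotient.mk'' s : orbitRel.Quotient Q α)).ncard *
      Nat.card (stabilizer Q s) = Nat.card Q := fun s ↦ by
    rw [orbitRel.Quotient.orbit_mk]
    exact hcard s
  have hmn : ∀ ω : orbitRel.Quotient Q α,
      ω.orbit.ncard * (Nat.card Q / ω.orbit.ncard) = Nat.card Q := fun ω ↦ by
    induction ω using Quotient.inductionOn' with
    | h s => exact Nat.mul_div_cancel' ⟨_, (horb s).symm⟩
  have hdiv : ∀ s : α, Nat.card Q /
      (orbitRel.Quotient.orbit (Quotient.mk'' s : orbitRel.Quotient Q α)).ncard =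
      Nat.card (stabilizer Q s) := fun s ↦ by
    have hpos : 0 < Nat.card Q := Nat.card_pos
    rw [← horb s] at hpos ⊢
    exact Nat.mul_div_cancel_left _ (Nat.pos_of_mul_pos_right hpos)
  have h3 : 3 ≤ Nat.card (stabilizer Q a) := by
    have hdvd : orderOf x ∣ Nat.card (stabilizer Q a) := by
      have := orderOf_dvd_natCard (⟨x, ha⟩ : stabilizer Q a)
      rwa [← Subgroup.orderOf_coe] at this
    have hle := Nat.le_of_dvd Nat.card_pos hdvd
    by_contra hlt
    have h4 : Nat.card (stabilizer Q a) = 2 := by have := hn a; omega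
    rw [h4] at hdvd
    exact hx (orderOf_dvd_iff_pow_eq_one.1 hdvd)
  rcases card_orbit_le_two_or_card_stabilizer_le_five _ _ hmn
    (fun ω ↦ by
      induction ω using Quotient.inductionOn' with
      | h s => rw [hdiv]; exact hn s)
    (sum_card_orbit_add h2) (Quotient.mk'' a) (by rw [hdiv]; exact h3) with h | h
  · left
    intro y
    rw [orbitRel.Quotient.orbit_mk] at h
    by_contra hne
    have hya : y • a ≠ a := fun h ↦ hne (by rw [h, ha])
    have hxya : x • y • a ≠ a := fun h ↦ hya (smul_left_cancel x (h.trans ha.symm))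
    have hsub : ({a, y • a, x • y • a} : Set α) ⊆ orbit Q a := by
      rintro s (rfl | rfl | rfl)
      · exact mem_orbit_self _
      · exact mem_orbit _ _
      · rw [smul_smul]; exact mem_orbit _ _
    have := Set.ncard_le_ncard hsub (Set.toFinite _)
    rw [Set.ncard_eq_three.2 ⟨_, _, _, hya.symm, hxya.symm, Ne.symm hne, rfl⟩] at this
    omega
  · right
    intro q
    by_cases hq : q = 1
    · exact ⟨2, le_rfl, by norm_num, by simp [hq]⟩
    obtain ⟨s, hs⟩ := Set.nonempty_of_ncard_ne_zero (s := fixedBy α q) (by rw [h2 q hq]; norm_num)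
    have h5 := h (Quotient.mk'' s)
    rw [hdiv] at h5
    refine ⟨_, hn s, h5, ?_⟩
    have := pow_card_eq_one' (x := (⟨q, hs⟩ : stabilizer Q s))
    exact congrArg Subtype.val this

open MulAction in
/-- Klein's dichotomy: if every nontrivial element of a finite group has exactly two fixed points,
then an element `x` with `x ^ 2 ≠ 1` either fixes the orbit of its fixed points, or all elements of
the group have small order. -/
theorem orbit_fixed_or_pow_eq_one {Q α : Type*} [Group Q] [Finite Q] [MulAction Q α]
    (h2 : ∀ q : Q, q ≠ 1 → (fixedBy α q).ncard = 2)
    {x : Q} (hx : x ^ 2 ≠ 1) {a : α} (ha : x • a = a) :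
    (∀ y : Q, x • y • a = y • a) ∨ ∀ q : Q, ∃ n, 2 ≤ n ∧ n ≤ 5 ∧ q ^ n = 1 := by
  let S : SubMulAction Q α :=
    { carrier := {s | ∃ q : Q, q ≠ 1 ∧ q • s = s}
      smul_mem' := by
        rintro g s ⟨q, hq, hqs⟩
        exact ⟨g * q * g⁻¹, fun h ↦ hq (conj_eq_one_iff.1 h), by simp [mul_smul, hqs]⟩ }
  have hfin : (S : Set α).Finite := by
    have : (S : Set α) ⊆ ⋃ q ∈ {q : Q | q ≠ 1}, fixedBy α q := by
      rintro s ⟨q, hq, hqs⟩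
      exact Set.mem_biUnion hq hqs
    refine (Set.Finite.biUnion (Set.toFinite _) fun q hq ↦ ?_).subset this
    exact Set.finite_of_ncard_ne_zero (by rw [h2 q hq]; norm_num)
  have : Finite S := hfin
  have h2S : ∀ q : Q, q ≠ 1 → (fixedBy S q).ncard = 2 := fun q hq ↦ by
    rw [← h2 q hq, ← Set.ncard_image_of_injective _ Subtype.val_injective]
    congr 1
    ext s
    simp only [Set.mem_image, mem_fixedBy]
    constructor
    · rintro ⟨t, ht, rfl⟩
      exact congrArg Subtype.val ht
    · intro hs
      exact ⟨⟨s, q, hq, hs⟩, Subtype.ext hs, rfl⟩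
  have hx1 : x ≠ 1 := by rintro rfl; simp at hx
  rcases orbit_fixed_or_pow_eq_one_of_finite h2S
    (fun s ↦ by
      obtain ⟨q, hq, hqs⟩ := s.2
      exact ⟨q, hq, Subtype.ext hqs⟩)
    hx (a := ⟨a, x, hx1, ha⟩) (Subtype.ext ha) with h | h
  · exact Or.inl fun y ↦ congrArg Subtype.val (h y)
  · exact Or.inr h

section Moebius

open OnePoint

/-- The action of `SL(2, F)` on the projective line over an extension `K` of `F`. -/
noncomputable def moebius (F K : Type*) [Field F] [Field K] [Algebra F K] :
    SL(2, F) →* Equiv.Perm (OnePoint K) :=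
  letI := Classical.decEq K
  (MulAction.toPermHom (GL (Fin 2) K) (OnePoint K)).comp
    (Matrix.SpecialLinearGroup.toGL.comp (Matrix.SpecialLinearGroup.map (algebraMap F K)))

variable {F K : Type*} [Field F] [Field K] [Algebra F K]

theorem moebius_infty (g : SL(2, F)) : moebius F K g ∞ = ∞ ↔ g 1 0 = 0 := by
  classical
  have : moebius F K g ∞ =
      Matrix.SpecialLinearGroup.toGL (Matrix.SpecialLinearGroup.map (algebraMap F K) g) •
        (∞ : OnePoint K) := by
    simp only [moebius, MonoidHom.comp_apply, MulAction.toPermHom_apply, MulAction.toPerm_apply]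
  rw [this, smul_infty_eq_self_iff]
  simp

theorem moebius_coe (g : SL(2, F)) (z w : K) : moebius F K g z = w ↔
    algebraMap F K (g 0 0) * z + algebraMap F K (g 0 1) =
      w * (algebraMap F K (g 1 0) * z + algebraMap F K (g 1 1)) := by
  classical
  have : moebius F K g z =
      Matrix.SpecialLinearGroup.toGL (Matrix.SpecialLinearGroup.map (algebraMap F K) g) •
        (z : OnePoint K) := by
    simp only [moebius, MonoidHom.comp_apply, MulAction.toPermHom_apply, MulAction.toPerm_apply]
  have hdet := congrArg (algebraMap F K) (g.det_coe)
  rw [Matrix.det_fin_two] at hdet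
  simp only [map_sub, map_mul, map_one] at hdet
  have hentry : ∀ i j, Matrix.SpecialLinearGroup.toGL
      (Matrix.SpecialLinearGroup.map (algebraMap F K) g) i j = algebraMap F K (g i j) :=
    fun _ _ ↦ rfl
  rw [this, smul_some_eq_ite]
  simp only [hentry]
  split_ifs with h
  · simp only [infty_ne_coe, false_iff, h, mul_zero]
    intro h'
    have : (1 : K) = 0 := by linear_combination -hdet + (algebraMap F K (g 0 0)) * h -
      (algebraMap F K (g 1 0)) * h'
    exact one_ne_zero this
  · rw [coe_eq_coe, div_eq_iff h]

/-- `g` is a scalar matrix. -/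
def IsScalar (g : SL(2, F)) : Prop := g 0 1 = 0 ∧ g 1 0 = 0 ∧ g 0 0 = g 1 1

theorem moebius_eq_one_iff (g : SL(2, F)) : moebius F K g = 1 ↔ IsScalar g := by
  have hinj := (algebraMap F K).injective
  constructor
  · intro h
    have h1 := (moebius_infty (K := K) g).1 (by rw [h]; rfl)
    have h2 := (moebius_coe (K := K) g 0 0).1 (by rw [h]; rfl)
    have h3 := (moebius_coe (K := K) g 1 1).1 (by rw [h]; rfl)
    have h4 : g 0 1 = 0 := hinj (by simpa using h2)
    exact ⟨h4, h1, hinj (by simpa [h1, h4] using h3)⟩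
  · rintro ⟨h1, h2, h3⟩
    ext z
    induction z with
    | infty => simpa using (moebius_infty (K := K) g).2 h2
    | coe z => simpa using (moebius_coe (K := K) g z z).2 (by simp [h1, h2, h3, mul_comm])

theorem ncard_fixedBy_moebius [IsAlgClosed K] (h2 : (2 : F) ≠ 0) (g : SL(2, F))
    (htr : (g 0 0 + g 1 1) ^ 2 ≠ 4) :
    {s : OnePoint K | moebius F K g s = s}.ncard = 2 := by
  have hinj := (algebraMap F K).injective
  have h2K : (2 : K) ≠ 0 := by
    simpa only [map_ofNat] using (map_ne_zero_iff (algebraMap F K) hinj).2 h2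
  have hdet := g.det_coe
  rw [Matrix.det_fin_two] at hdet
  have hdisc : discrim (g 1 0) (g 1 1 - g 0 0) (-g 0 1) ≠ 0 := by
    intro h
    rw [discrim] at h
    exact htr (by linear_combination h + 4 * hdet)
  rw [Set.ncard_eq_two]
  by_cases hc : g 1 0 = 0
  · have hne : g 1 1 - g 0 0 ≠ 0 := by
      intro h
      exact hdisc (by simp [discrim, hc, h])
    have hneK : algebraMap F K (g 1 1 - g 0 0) ≠ 0 := (map_ne_zero_iff _ hinj).2 hne
    refine ⟨∞, ((algebraMap F K (g 0 1) / algebraMap F K (g 1 1 - g 0 0) : K) : OnePoint K),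
      infty_ne_coe _, ?_⟩
    ext s
    induction s with
    | infty => simpa using (moebius_infty (K := K) g).2 hc
    | coe z =>
      simp only [Set.mem_ofPred_eq, moebius_coe, Set.mem_insert_iff, coe_ne_infty,
        Set.mem_singleton_iff, coe_eq_coe, false_or, hc, map_zero, eq_div_iff hneK]
      rw [map_sub]
      constructor <;> intro h <;> linear_combination -h
  · have hcK : algebraMap F K (g 1 0) ≠ 0 := (map_ne_zero_iff _ hinj).2 hc
    have hdK : discrim (algebraMap F K (g 1 0)) (algebraMap F K (g 1 1) - algebraMap F K (g 0 0))
        (-algebraMap F K (g 0 1)) ≠ 0 := by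
      simpa only [discrim, map_sub, map_mul, map_pow, map_neg, map_ofNat] using
        (map_ne_zero_iff _ hinj).2 hdisc
    obtain ⟨r, hr⟩ := IsAlgClosed.exists_pow_nat_eq (discrim (algebraMap F K (g 1 0))
      (algebraMap F K (g 1 1) - algebraMap F K (g 0 0)) (-algebraMap F K (g 0 1))) zero_lt_two
    have hr0 : r ≠ 0 := by rintro rfl; simp at hr; exact hdK hr.symm
    have : NeZero (2 : K) := ⟨h2K⟩
    obtain ⟨z₁, z₂, hne, hq⟩ : ∃ z₁ z₂ : K, z₁ ≠ z₂ ∧ ∀ z, algebraMap F K (g 1 0) * (z * z) +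
        (algebraMap F K (g 1 1) - algebraMap F K (g 0 0)) * z + -algebraMap F K (g 0 1) = 0 ↔
        z = z₁ ∨ z = z₂ := by
      refine ⟨_, _, fun h ↦ ?_, fun z ↦ quadratic_eq_zero_iff hcK (hr.symm.trans (sq r)) z⟩
      field_simp at h
      have : 2 * r = 0 := by linear_combination h
      simp_all
    refine ⟨z₁, z₂, coe_injective.ne hne, ?_⟩
    ext s
    induction s with
    | infty =>
      refine iff_of_false (fun h ↦ hc ((moebius_infty (K := K) g).1 h)) ?_
      rintro (h | h) <;> exact infty_ne_coe _ h
    | coe z =>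
      rw [Set.mem_ofPred_eq, Set.mem_insert_iff, Set.mem_singleton_iff, coe_eq_coe, coe_eq_coe,
        ← hq z, moebius_coe]
      constructor <;> intro h <;> linear_combination -h

theorem mem_center_iff_isScalar (g : SL(2, F)) :
    g ∈ Subgroup.center SL(2, F) ↔ IsScalar g := by
  rw [Matrix.SpecialLinearGroup.mem_center_iff]
  constructor
  · rintro ⟨r, -, hr⟩
    simp [IsScalar, ← hr]
  · rintro ⟨h1, h2, h3⟩
    have hdet := g.det_coe
    rw [Matrix.det_fin_two, h1, h2, ← h3] at hdet
    refine ⟨g 0 0, by simpa [sq] using hdet, ?_⟩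
    ext i j
    fin_cases i <;> fin_cases j <;> simp [h1, h2, h3]

theorem mul_entry (g h : SL(2, F)) (i j : Fin 2) :
    (g * h) i j = g i 0 * h 0 j + g i 1 * h 1 j := by
  rw [Matrix.SpecialLinearGroup.coe_mul, Matrix.mul_apply, Fin.sum_univ_two]

theorem ext_entries_s8 {g h : SL(2, F)} (h00 : g 0 0 = h 0 0) (h01 : g 0 1 = h 0 1)
    (h10 : g 1 0 = h 1 0) (h11 : g 1 1 = h 1 1) : g = h := by
  ext i j
  fin_cases i <;> fin_cases j <;> assumption

theorem entry_pow_add_two (h : SL(2, F)) (n : ℕ) (i j : Fin 2) :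
    (h ^ (n + 2)) i j = (h 0 0 + h 1 1) * (h ^ (n + 1)) i j - (h ^ n) i j := by
  have hdet := h.det_coe
  rw [Matrix.det_fin_two] at hdet
  rw [pow_succ _ (n + 1), pow_succ _ n]
  simp only [mul_entry]
  fin_cases j <;> simp only [Fin.zero_eta, Fin.mk_one, Fin.isValue]
  · linear_combination (-(h ^ n) i 0) * hdet
  · linear_combination (-(h ^ n) i 1) * hdet

open Polynomial in
/-- The roots of this polynomial are the traces of the elements of `SL(2, F)` whose image in
`PSL(2, F)` has order between `2` and `5`. -/
noncomputable def smallOrderPoly (F : Type*) [Field F] : F[X] :=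
  X * (X ^ 2 - 1) * (X ^ 2 - 2) * (X ^ 4 - 3 * X ^ 2 + 1)

open Polynomial in
theorem natDegree_smallOrderPoly : (smallOrderPoly F).natDegree = 9 := by
  unfold smallOrderPoly
  compute_degree!

theorem smallOrderPoly_ne_zero : smallOrderPoly F ≠ 0 :=
  Polynomial.ne_zero_of_natDegree_gt (n := 0) (by rw [natDegree_smallOrderPoly]; norm_num)

theorem isRoot_smallOrderPoly_iff (t : F) : (smallOrderPoly F).IsRoot t ↔
    t * (t ^ 2 - 1) * (t ^ 2 - 2) * (t ^ 4 - 3 * t ^ 2 + 1) = 0 := by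
  simp [smallOrderPoly, Polynomial.IsRoot]

theorem isRoot_trace_of_isScalar_pow {h : SL(2, F)} (hh : ¬ IsScalar h) {n : ℕ} (h2 : 2 ≤ n)
    (h5 : n ≤ 5) (hn : IsScalar (h ^ n)) : (smallOrderPoly F).IsRoot (h 0 0 + h 1 1) := by
  set t := h 0 0 + h 1 1 with ht
  have key : ∀ L : SL(2, F) → F,
      (∀ k, L (h ^ (k + 2)) = t * L (h ^ (k + 1)) - L (h ^ k)) → L 1 = 0 →
      L (h ^ n) = 0 → L h ≠ 0 → (smallOrderPoly F).IsRoot t := by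
    intro L hrec h1 hLn hL
    have e2 := hrec 0
    have e3 := hrec 1
    have e4 := hrec 2
    have e5 := hrec 3
    simp only [zero_add, pow_zero, pow_one, h1, sub_zero, Nat.reduceAdd] at e2 e3 e4 e5
    rw [isRoot_smallOrderPoly_iff]
    apply mul_left_cancel₀ hL
    interval_cases n
    · linear_combination (t ^ 2 - 1) * (t ^ 2 - 2) * (t ^ 4 - 3 * t ^ 2 + 1) * (hLn - e2)
    · linear_combination t * (t ^ 2 - 2) * (t ^ 4 - 3 * t ^ 2 + 1) * (hLn - e3 - t * e2)
    · linear_combination (t ^ 2 - 1) * (t ^ 4 - 3 * t ^ 2 + 1) *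
        (hLn - e4 - t * e3 - (t ^ 2 - 1) * e2)
    · linear_combination t * (t ^ 2 - 1) * (t ^ 2 - 2) *
        (hLn - e5 - t * e4 - (t ^ 2 - 1) * e3 - (t ^ 3 - 2 * t) * e2)
  obtain ⟨n1, n2, n3⟩ := hn
  by_contra hroot
  refine hh ⟨?_, ?_, ?_⟩
  · by_contra hL
    exact hroot (key (fun g ↦ g 0 1) (fun k ↦ entry_pow_add_two h k 0 1) (by simp) n1 hL)
  · by_contra hL
    exact hroot (key (fun g ↦ g 1 0) (fun k ↦ entry_pow_add_two h k 1 0) (by simp) n2 hL)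
  · by_contra hL
    refine hroot (key (fun g ↦ g 0 0 - g 1 1) (fun k ↦ ?_) (by simp) (sub_eq_zero.2 n3)
      (sub_ne_zero.2 hL))
    simp only [entry_pow_add_two]
    ring

/-- `X` has no eigenvector over `F`: the quadratic form `det (w, X w)` is anisotropic. -/
def IsAnisotropic (X : SL(2, F)) : Prop :=
  ∀ u v : F, X 1 0 * u ^ 2 + (X 1 1 - X 0 0) * u * v - X 0 1 * v ^ 2 = 0 → u = 0 ∧ v = 0

theorem IsAnisotropic.apply_one_zero_ne {X : SL(2, F)} (hX : IsAnisotropic X) : X 1 0 ≠ 0 :=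
  fun h ↦ one_ne_zero (hX 1 0 (by simp [h])).1

open Matrix in
theorem isAnisotropic_of_orderOf {p : ℕ} [Fact p.Prime] (X : SL(2, ZMod p))
    (h2 : 2 < orderOf (QuotientGroup.mk X : PSL(2, ZMod p)))
    (hdvd : orderOf (QuotientGroup.mk X : PSL(2, ZMod p)) ∣ p + 1) : IsAnisotropic X := by
  have hp : p.Prime := Fact.out
  have hdet := X.det_coe
  rw [Matrix.det_fin_two] at hdet
  have horder : ∀ n, IsScalar (X ^ n) → orderOf (QuotientGroup.mk X : PSL(2, ZMod p)) ∣ n :=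
    fun n hn ↦ orderOf_dvd_of_pow_eq_one (by
      rw [← QuotientGroup.mk_pow, QuotientGroup.eq_one_iff]
      exact (mem_center_iff_isScalar _).2 hn)
  intro u v huv
  by_contra hne
  obtain ⟨a, ha⟩ : ∃ a, a ^ 2 - (X 0 0 + X 1 1) * a + 1 = 0 := by
    by_cases hv : v = 0
    · have hu : u ≠ 0 := fun h ↦ hne ⟨h, hv⟩
      have hc : X 1 0 = 0 := by simpa [hv, hu] using huv
      refine ⟨X 0 0, ?_⟩
      rw [hc] at hdet
      linear_combination -hdet
    · refine ⟨(X 1 0 * u + X 1 1 * v) / v, ?_⟩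
      field_simp
      linear_combination X 1 0 * huv - v ^ 2 * hdet
  set b := X 0 0 + X 1 1 - a with hb
  have hab : a * b = 1 := by rw [hb]; linear_combination -ha
  set M : Matrix (Fin 2) (Fin 2) (ZMod p) := X.1 with hM
  have hpow : ∀ n, (X ^ n).1 = M ^ n := fun n ↦ Matrix.SpecialLinearGroup.coe_pow X n
  have hscalar : ∀ n (r : ZMod p), M ^ n = scalar (Fin 2) r → IsScalar (X ^ n) := fun n r h ↦ by
    have h' : (X ^ n).1 = scalar (Fin 2) r := (hpow n).trans h
    refine ⟨?_, ?_, ?_⟩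
    · simpa using congrFun (congrFun h' 0) 1
    · simpa using congrFun (congrFun h' 1) 0
    · exact (by simpa using congrFun (congrFun h' 0) 0 : (X ^ n) 0 0 = r).trans
        (by simpa using congrFun (congrFun h' 1) 1 : (X ^ n) 1 1 = r).symm
  have hstep : ∀ {c d : ZMod p}, c + d = X 0 0 + X 1 1 → c * d = 1 →
      M * (M - scalar (Fin 2) d) = c • (M - scalar (Fin 2) d) := by
    intro c d hs hp
    ext i j
    fin_cases i <;> fin_cases j <;> simp [Matrix.mul_apply, Fin.sum_univ_two, hM]
    · linear_combination (-X 0 0) * hs - hdet + hp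
    · linear_combination (-X 0 1) * hs
    · linear_combination (-X 1 0) * hs
    · linear_combination (-X 1 1) * hs - hdet + hp
  have hpowstep : ∀ {c d : ZMod p}, c + d = X 0 0 + X 1 1 → c * d = 1 → ∀ n : ℕ,
      M ^ n * (M - scalar (Fin 2) d) = c ^ n • (M - scalar (Fin 2) d) := by
    intro c d hs hp n
    induction n with
    | zero => simp
    | succ n ih => rw [pow_succ, mul_assoc, hstep hs hp, mul_smul_comm, ih, smul_smul, pow_succ']
  by_cases hne' : a = b
  · have hsq : (M - scalar (Fin 2) a) ^ 2 = 0 := by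
      rw [sq, sub_mul, hstep (c := a) (d := a) (by rw [hb] at hne'; linear_combination hne')
        (by rw [← hne'] at hab; exact hab)]
      simp [Matrix.scalar_apply, ← Matrix.smul_one_eq_diagonal]
    have hzero : M ^ p = scalar (Fin 2) (a ^ p) := by
      rw [map_pow, ← sub_eq_zero,
        ← sub_pow_char_of_commute p (scalar_commute _ (fun _ ↦ Commute.all _ _) _).symm]
      exact pow_eq_zero_of_le hp.two_le hsq
    have h1 := horder p (hscalar p _ hzero)
    have h3 : orderOf (QuotientGroup.mk X : PSL(2, ZMod p)) ∣ 1 :=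
      (Nat.dvd_add_right h1).1 hdvd
    have := Nat.le_of_dvd one_pos h3
    omega
  · have ha0 : a ≠ 0 := left_ne_zero_of_mul_eq_one hab
    have hb0 : b ≠ 0 := right_ne_zero_of_mul_eq_one hab
    have e1 := hpowstep (c := a) (d := b) (by rw [hb]; ring) hab (p - 1)
    have e2 := hpowstep (c := b) (d := a) (by rw [hb]; ring) (by rw [mul_comm]; exact hab) (p - 1)
    rw [ZMod.pow_card_sub_one_eq_one ha0, one_smul] at e1
    rw [ZMod.pow_card_sub_one_eq_one hb0, one_smul] at e2
    have e3 : M ^ (p - 1) * scalar (Fin 2) (a - b) = scalar (Fin 2) (a - b) := by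
      rw [map_sub]
      linear_combination (norm := noncomm_ring) e1 - e2
    have e4 : M ^ (p - 1) = scalar (Fin 2) 1 := by
      have := congrArg (· * scalar (Fin 2) (a - b)⁻¹) e3
      simp only [mul_assoc, ← map_mul] at this
      rwa [mul_inv_cancel₀ (sub_ne_zero.2 hne'), map_one, mul_one] at this
    have h1 := horder (p - 1) (hscalar _ _ e4)
    have h3 : orderOf (QuotientGroup.mk X : PSL(2, ZMod p)) ∣ 2 := by
      have h4 : p + 1 = (p - 1) + 2 := by have := hp.two_le; omega
      rw [h4] at hdvd
      exact (Nat.dvd_add_right h1).1 hdvd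
    have := Nat.le_of_dvd two_pos h3
    omega

/-- The upper unitriangular matrices. -/
def upper (t : F) : SL(2, F) := ⟨!![1, t; 0, 1], by simp⟩

/-- The lower unitriangular matrices. -/
def lower (t : F) : SL(2, F) := ⟨!![1, 0; t, 1], by simp⟩

@[simp] theorem upper_zero_zero (t : F) : upper t 0 0 = 1 := rfl
@[simp] theorem upper_zero_one (t : F) : upper t 0 1 = t := rfl
@[simp] theorem upper_one_zero (t : F) : upper t 1 0 = 0 := rfl
@[simp] theorem upper_one_one (t : F) : upper t 1 1 = 1 := rfl
@[simp] theorem lower_zero_zero (t : F) : lower t 0 0 = 1 := rfl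
@[simp] theorem lower_zero_one (t : F) : lower t 0 1 = 0 := rfl
@[simp] theorem lower_one_zero (t : F) : lower t 1 0 = t := rfl
@[simp] theorem lower_one_one (t : F) : lower t 1 1 = 1 := rfl

theorem upper_pow (s : F) (n : ℕ) : upper s ^ n = upper (n * s) := by
  induction n with
  | zero => apply ext_entries_s8 <;> simp
  | succ n ih =>
    rw [pow_succ, ih]
    apply ext_entries_s8 <;> simp [mul_entry]
    ring

theorem eq_top_of_upper_mem {p : ℕ} [Fact p.Prime] {H : Subgroup SL(2, ZMod p)} {s : ZMod p}
    (hs : s ≠ 0) (hsH : upper s ∈ H) {g : SL(2, ZMod p)} (hg : g ∈ H) (hg0 : g 1 0 ≠ 0) :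
    H = ⊤ := by
  have hup : ∀ t, upper t ∈ H := fun t ↦ by
    have := H.pow_mem hsH (t / s).val
    rwa [upper_pow, ZMod.natCast_zmod_val, div_mul_cancel₀ _ hs] at this
  have hlow : ∀ t, lower t ∈ H := fun t ↦ by
    have hw := H.mul_mem (H.mul_mem (hup (-g 0 0 / g 1 0)) hg) (hup (-g 1 1 / g 1 0))
    have := H.mul_mem (H.mul_mem hw (hup (-t / g 1 0 ^ 2))) (H.inv_mem hw)
    convert this using 1
    rw [eq_mul_inv_iff_mul_eq]
    have hdet := g.det_coe
    rw [Matrix.det_fin_two] at hdet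
    apply ext_entries_s8 <;> simp [mul_entry] <;> field_simp <;> grind
  have hgen : ∀ k : SL(2, ZMod p), k 1 0 ≠ 0 → k ∈ H := fun k hk ↦ by
    have := H.mul_mem (H.mul_mem (hup ((k 0 0 - 1) / k 1 0)) (hlow (k 1 0)))
      (hup ((k 1 1 - 1) / k 1 0))
    convert this using 1
    have hdet := k.det_coe
    rw [Matrix.det_fin_two] at hdet
    apply ext_entries_s8 <;> simp [mul_entry] <;> field_simp <;> grind
  rw [Subgroup.eq_top_iff']
  intro k
  by_cases hk : k 1 0 = 0
  · have hdet := k.det_coe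
    rw [Matrix.det_fin_two, hk] at hdet
    have := hgen (k * lower 1) (by
      simp [mul_entry, hk]
      rintro h
      simp [h] at hdet)
    exact (H.mul_mem_cancel_right (hlow 1)).1 this
  · exact hgen k hk

theorem eq_top_of_trace_eq_two {p : ℕ} [Fact p.Prime] {H : Subgroup SL(2, ZMod p)}
    {X : SL(2, ZMod p)} (hX : IsAnisotropic X) (hXH : X ∈ H) {u : SL(2, ZMod p)} (hu : u ∈ H)
    (hu1 : u ≠ 1) (htr : u 0 0 + u 1 1 = 2) : H = ⊤ := by
  have hdet := u.det_coe
  rw [Matrix.det_fin_two] at hdet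
  by_cases hc : u 1 0 = 0
  · have h00 : u 0 0 = 1 := by
      have : (u 0 0 - 1) ^ 2 = 0 := by linear_combination u 0 0 * htr - hdet - u 0 1 * hc
      exact sub_eq_zero.1 (pow_eq_zero_iff two_ne_zero |>.1 this)
    have h11 : u 1 1 = 1 := by linear_combination htr - h00
    have hup : upper (u 0 1) = u := by
      ext i j
      fin_cases i <;> fin_cases j <;> simp [upper, h00, h11, hc]
    refine eq_top_of_upper_mem (s := u 0 1) (fun h ↦ hu1 ?_) (hup ▸ hu) hXH hX.apply_one_zero_ne
    ext i j
    fin_cases i <;> fin_cases j <;> simp [h00, h11, hc, h]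
  · obtain ⟨q, hq⟩ : ∃ q, q * u 1 0 = u 0 0 - 1 := ⟨_, div_mul_cancel₀ _ hc⟩
    obtain ⟨P, h00, h01, h10, h11⟩ : ∃ P : SL(2, ZMod p),
        P 0 0 = q ∧ P 0 1 = -1 ∧ P 1 0 = 1 ∧ P 1 1 = 0 :=
      ⟨⟨!![q, -1; 1, 0], by simp⟩, rfl, rfl, rfl, rfl⟩
    obtain ⟨i00, i01, i10, i11⟩ : P⁻¹ 0 0 = 0 ∧ P⁻¹ 0 1 = 1 ∧ P⁻¹ 1 0 = -1 ∧ P⁻¹ 1 1 = q := by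
      simp [Matrix.SpecialLinearGroup.coe_inv, Matrix.adjugate_fin_two, h00, h01, h10, h11]
    have htop : H.map (MulAut.conj P⁻¹).toMonoidHom = ⊤ := by
      refine eq_top_of_upper_mem (s := -u 1 0) (neg_ne_zero.2 hc) ⟨u, hu, ?_⟩
        ⟨X, hXH, rfl⟩ (fun h ↦ ?_)
      · simp only [MulEquiv.coe_toMonoidHom, MulAut.conj_apply, inv_inv]
        apply ext_entries_s8 <;> simp [mul_entry, h00, h01, h10, h11, i00, i01, i10, i11] <;> grind
      · simp only [MulEquiv.coe_toMonoidHom, MulAut.conj_apply, inv_inv] at h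
        simp only [mul_entry, h00, h10, i10, i11] at h
        exact one_ne_zero (hX q 1 (by linear_combination h)).2
    exact Subgroup.map_injective (MulAut.conj P⁻¹).injective
      (htop.trans (Subgroup.map_top_of_surjective _ (MulAut.conj P⁻¹).surjective).symm)

theorem commute_or_trace_eq_zero {X Y : SL(2, F)} (hX : IsAnisotropic X) {a : OnePoint K}
    (ha : moebius F K X a = a) (hY : moebius F K X (moebius F K Y a) = moebius F K Y a) :
    X * Y = Y * X ∨ Y 0 0 + Y 1 1 = 0 ∧ (X * Y) 0 0 + (X * Y) 1 1 = 0 := by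
  have hX10 := hX.apply_one_zero_ne
  have hinfty : ∀ b : OnePoint K, moebius F K X b = b → ∃ z : K, b = z := fun b hb ↦ by
    induction b using OnePoint.rec with
    | infty => exact absurd ((moebius_infty X).1 hb) hX10
    | coe z => exact ⟨z, rfl⟩
  obtain ⟨w, hw⟩ := hinfty _ hY
  obtain ⟨z, rfl⟩ := hinfty _ ha
  rw [hw] at hY
  rw [moebius_coe] at ha hY hw
  have hlin : ∀ r s : F, algebraMap F K r * z + algebraMap F K s = 0 → r = 0 ∧ s = 0 := by
    intro r s h
    obtain ⟨hs, hr⟩ := hX (-s) r (by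
      apply (algebraMap F K).injective
      simp only [map_add, map_sub, map_mul, map_pow, map_neg, map_zero]
      linear_combination (-(algebraMap F K r) ^ 2) * ha +
        (algebraMap F K (X 1 0) * (algebraMap F K s - algebraMap F K r * z) -
          algebraMap F K r * (algebraMap F K (X 1 1) - algebraMap F K (X 0 0))) * h)
    exact ⟨hr, neg_eq_zero.1 hs⟩
  by_cases hwz : w = z
  · left
    subst hwz
    obtain ⟨hr, hs⟩ := hlin ((Y 1 1 - Y 0 0) * X 1 0 - Y 1 0 * (X 1 1 - X 0 0))
      (Y 1 0 * X 0 1 - Y 0 1 * X 1 0) (by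
        simp only [map_sub, map_mul]
        linear_combination algebraMap F K (Y 1 0) * ha - algebraMap F K (X 1 0) * hw)
    apply ext_entries_s8 <;> simp only [mul_entry]
    · linear_combination hs
    · apply mul_left_cancel₀ hX10
      linear_combination X 0 1 * hr + (X 1 1 - X 0 0) * hs
    · linear_combination -hr
    · linear_combination -hs
  · right
    have hsum : algebraMap F K (X 1 0) * (w + z) =
        algebraMap F K (X 0 0) - algebraMap F K (X 1 1) := by
      apply mul_left_cancel₀ (sub_ne_zero.2 hwz)
      linear_combination ha - hY
    obtain ⟨hr, hs⟩ := hlin (X 1 0 * (Y 0 0 + Y 1 1))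
      (X 1 0 * Y 0 1 - (X 0 0 - X 1 1) * Y 1 1 + Y 1 0 * X 0 1) (by
        simp only [map_add, map_sub, map_mul]
        linear_combination algebraMap F K (X 1 0) * hw + algebraMap F K (Y 1 0) * ha +
          (algebraMap F K (Y 1 0) * z + algebraMap F K (Y 1 1)) * hsum)
    have htr : Y 0 0 + Y 1 1 = 0 := (mul_eq_zero.1 hr).resolve_left hX10
    refine ⟨htr, ?_⟩
    simp only [mul_entry]
    linear_combination hs + X 0 0 * htr

theorem two_ne_zero_zmod {p : ℕ} (hp : 2 < p) : (2 : ZMod p) ≠ 0 := by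
  have : ((2 : ℕ) : ZMod p) ≠ 0 := by
    rw [Ne, ZMod.natCast_eq_zero_iff]
    exact Nat.not_dvd_of_pos_of_lt two_pos hp
  exact_mod_cast this

/-- Two elements of a proper subgroup, the first anisotropic, either commute or have traces
confined to a short list. -/
theorem commute_or_isRoot_trace {p : ℕ} [Fact p.Prime] (hp : 2 < p) {H : Subgroup SL(2, ZMod p)}
    (hH : H ≠ ⊤) (hneg : -1 ∈ H) {X Y : SL(2, ZMod p)} (hX : IsAnisotropic X)
    (hX2 : ¬ IsScalar (X ^ 2)) (hXH : X ∈ H) (hYH : Y ∈ H) :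
    X * Y = Y * X ∨ (smallOrderPoly (ZMod p)).IsRoot (Y 0 0 + Y 1 1) ∧
      (smallOrderPoly (ZMod p)).IsRoot ((X * Y) 0 0 + (X * Y) 1 1) := by
  have h2 := two_ne_zero_zmod hp
  let K := AlgebraicClosure (ZMod p)
  have htrace : ∀ h ∈ H, ¬ IsScalar h → (h 0 0 + h 1 1) ^ 2 ≠ 4 := by
    intro h hh hns htr
    have hone : ∀ g : SL(2, ZMod p), g = 1 → IsScalar g := by
      rintro _ rfl
      simp [IsScalar]
    rcases mul_eq_zero.1 (by linear_combination htr :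
      (h 0 0 + h 1 1 - 2) * (h 0 0 + h 1 1 + 2) = 0) with h0 | h0
    · exact hH (eq_top_of_trace_eq_two hX hXH hh (fun h1 ↦ hns (hone h h1)) (sub_eq_zero.1 h0))
    · refine hH (eq_top_of_trace_eq_two hX hXH (H.mul_mem hneg hh) (fun h1 ↦ hns ?_) ?_)
      · have := hone _ h1
        simpa [IsScalar] using this
      · simp only [neg_mul, one_mul, Matrix.SpecialLinearGroup.coe_neg, Matrix.neg_apply]
        linear_combination -h0
  let Q := H.map (moebius (ZMod p) K)
  have : Finite Q := ((H : Set SL(2, ZMod p)).toFinite.image _).to_subtype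
  let x : Q := ⟨moebius (ZMod p) K X, X, hXH, rfl⟩
  have hfix : ∀ q : Q, q ≠ 1 → (MulAction.fixedBy (OnePoint K) q).ncard = 2 := by
    rintro ⟨_, h, hh, rfl⟩ hq
    refine ncard_fixedBy_moebius h2 h (htrace h hh fun hs ↦ hq ?_)
    exact Subtype.ext ((moebius_eq_one_iff h).2 hs)
  have hx2 : x ^ 2 ≠ 1 := fun h ↦ hX2 ((moebius_eq_one_iff (K := K) _).1 (by
    rw [map_pow]
    exact congrArg Subtype.val h))
  have hx1 : x ≠ 1 := fun h ↦ hx2 (by rw [h, one_pow])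
  obtain ⟨a, ha⟩ : (MulAction.fixedBy (OnePoint K) x).Nonempty :=
    Set.nonempty_of_ncard_ne_zero (by rw [hfix x hx1]; norm_num)
  rcases orbit_fixed_or_pow_eq_one hfix hx2 ha with h | h
  · have h0 : (smallOrderPoly (ZMod p)).IsRoot 0 := by
      rw [isRoot_smallOrderPoly_iff]
      ring
    refine (commute_or_trace_eq_zero hX ha (h ⟨moebius (ZMod p) K Y, Y, hYH, rfl⟩)).imp_right ?_
    rintro ⟨h1, h2⟩
    rw [h1, h2]
    exact ⟨h0, h0⟩
  · have hroot : ∀ g ∈ H, ¬ IsScalar g → (smallOrderPoly (ZMod p)).IsRoot (g 0 0 + g 1 1) := by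
      intro g hg hgs
      obtain ⟨n, hn2, hn5, hn⟩ := h ⟨moebius (ZMod p) K g, g, hg, rfl⟩
      refine isRoot_trace_of_isScalar_pow hgs hn2 hn5 ((moebius_eq_one_iff (K := K) _).1 ?_)
      rw [map_pow]
      exact congrArg Subtype.val hn
    by_cases hcomm : X * Y = Y * X
    · exact .inl hcomm
    refine .inr ⟨hroot Y hYH fun hs ↦ hcomm ?_, hroot _ (H.mul_mem hXH hYH) fun hs ↦ hcomm ?_⟩
    · exact Subgroup.mem_center_iff.1 ((mem_center_iff_isScalar Y).2 hs) X
    · have := Subgroup.mem_center_iff.1 ((mem_center_iff_isScalar (X * Y)).2 hs) X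
      rw [mul_assoc] at this
      exact mul_left_cancel this

/-- A conic without points at infinity has at most `|F| + 2` points. -/
theorem ncard_conic_le_s8 [Finite F] {A B C : F} (D E G : F)
    (h : ∀ u v : F, A * u ^ 2 + B * u * v + C * v ^ 2 = 0 → u = 0 ∧ v = 0) :
    {P : F × F | A * P.1 ^ 2 + B * P.1 * P.2 + C * P.2 ^ 2 + D * P.1 + E * P.2 + G = 0}.ncard ≤
      Nat.card F + 2 := by
  classical
  set S := {P : F × F | A * P.1 ^ 2 + B * P.1 * P.2 + C * P.2 ^ 2 + D * P.1 + E * P.2 + G = 0}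
  rcases S.eq_empty_or_nonempty with hS | ⟨⟨a, c⟩, h₀⟩
  · simp [hS]
  have h₀' : A * a ^ 2 + B * a * c + C * c ^ 2 + D * a + E * c + G = 0 := h₀
  have hC : C ≠ 0 := fun hC ↦ one_ne_zero (h 0 1 (by simp [hC])).2
  let f : F × F → Option F := fun P ↦ if P.1 = a then none else Option.some ((P.2 - c) / (P.1 - a))
  have hf : Set.InjOn f (S \ {(a, c)}) := by
    rintro ⟨a₁, c₁⟩ ⟨h₁, hne₁⟩ ⟨a₂, c₂⟩ ⟨h₂, hne₂⟩ heq
    replace h₁ : A * a₁ ^ 2 + B * a₁ * c₁ + C * c₁ ^ 2 + D * a₁ + E * c₁ + G = 0 := h₁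
    replace h₂ : A * a₂ ^ 2 + B * a₂ * c₂ + C * c₂ ^ 2 + D * a₂ + E * c₂ + G = 0 := h₂
    by_cases e₁ : a₁ = a <;> by_cases e₂ : a₂ = a <;> simp only [f, e₁, e₂, if_true, if_false,
      reduceCtorEq, Option.some.injEq] at heq
    · subst e₁
      subst e₂
      have k₁ : c₁ - c ≠ 0 := sub_ne_zero.2 (by rintro rfl; exact hne₁ rfl)
      have k₂ : c₂ - c ≠ 0 := sub_ne_zero.2 (by rintro rfl; exact hne₂ rfl)
      have := mul_left_cancel₀ (mul_ne_zero hC (mul_ne_zero k₁ k₂)) (by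
        linear_combination (c₂ - c) * (h₁ - h₀') - (c₁ - c) * (h₂ - h₀') :
        C * ((c₁ - c) * (c₂ - c)) * c₁ = C * ((c₁ - c) * (c₂ - c)) * c₂)
      rw [this]
    · have k₁ : a₁ - a ≠ 0 := sub_ne_zero.2 e₁
      have k₂ : a₂ - a ≠ 0 := sub_ne_zero.2 e₂
      obtain ⟨m, hm⟩ : ∃ m, m = (c₁ - c) / (a₁ - a) := ⟨_, rfl⟩
      have hm₂ : c₂ = m * (a₂ - a) + c := by rw [hm, heq]; field_simp; ring
      have hm₁ : c₁ = m * (a₁ - a) + c := by rw [hm]; field_simp; ring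
      have hq : A + B * m + C * m ^ 2 ≠ 0 := fun hq ↦
        one_ne_zero (h 1 m (by linear_combination hq)).1
      subst hm₁ hm₂
      have := mul_left_cancel₀ (mul_ne_zero hq (mul_ne_zero k₁ k₂)) (by
        linear_combination (a₂ - a) * (h₁ - h₀') - (a₁ - a) * (h₂ - h₀') :
        (A + B * m + C * m ^ 2) * ((a₁ - a) * (a₂ - a)) * a₁ =
          (A + B * m + C * m ^ 2) * ((a₁ - a) * (a₂ - a)) * a₂)
      rw [this]
  have h1 := Set.ncard_le_ncard_of_injOn f (fun _ _ ↦ Set.mem_univ _) hf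
  rw [Set.ncard_univ, Finite.card_option] at h1
  have h2 := Set.ncard_sdiff_singleton_add_one h₀
  omega

theorem ncard_commuting_le [Finite F] {X : SL(2, F)} (hX : IsAnisotropic X) :
    {Y : SL(2, F) | X * Y = Y * X}.ncard ≤ Nat.card F + 2 := by
  have hX10 := hX.apply_one_zero_ne
  have hentry : ∀ Y : SL(2, F), X * Y = Y * X →
      X 1 0 * Y 0 1 = X 0 1 * Y 1 0 ∧ X 1 0 * Y 1 1 = X 1 0 * Y 0 0 + (X 1 1 - X 0 0) * Y 1 0 := by
    intro Y hY
    have h0 := congrArg (fun g : SL(2, F) ↦ g 0 0) hY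
    have h1 := congrArg (fun g : SL(2, F) ↦ g 1 0) hY
    simp only [mul_entry] at h0 h1
    exact ⟨by linear_combination -h0, by linear_combination -h1⟩
  refine le_trans (Set.ncard_le_ncard_of_injOn (fun Y ↦ (Y 0 0, Y 1 0)) (fun Y hY ↦ ?_) ?_)
    (ncard_conic_le_s8 (A := X 1 0) (B := X 1 1 - X 0 0) (C := -X 0 1) 0 0 (-X 1 0)
      fun u v h ↦ hX u v (by linear_combination h))
  · obtain ⟨h1, h2⟩ := hentry Y hY
    have hdet := Y.det_coe
    rw [Matrix.det_fin_two] at hdet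
    show _ = _
    linear_combination X 1 0 * hdet - Y 0 0 * h2 + Y 1 0 * h1
  · intro Y hY Z hZ h
    obtain ⟨hY1, hY2⟩ := hentry Y hY
    obtain ⟨hZ1, hZ2⟩ := hentry Z hZ
    obtain ⟨h0, h1⟩ := Prod.mk.injEq .. ▸ h
    refine ext_entries_s8 h0 (mul_left_cancel₀ hX10 ?_) h1 (mul_left_cancel₀ hX10 ?_)
    · rw [hY1, hZ1, h1]
    · rw [hY2, hZ2, h0, h1]

theorem ncard_trace_eq_le [Finite F] {X : SL(2, F)} (hX : IsAnisotropic X) (t s : F) :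
    {Y : SL(2, F) | Y 0 0 + Y 1 1 = t ∧ (X * Y) 0 0 + (X * Y) 1 1 = s}.ncard ≤
      Nat.card F + 2 := by
  have hX10 := hX.apply_one_zero_ne
  refine le_trans (Set.ncard_le_ncard_of_injOn (fun Y ↦ (Y 0 0, Y 1 0)) (fun Y hY ↦ ?_) ?_)
    (ncard_conic_le_s8 (A := X 1 0) (B := X 1 1 - X 0 0) (C := -X 0 1) (-(X 1 0 * t))
      (s - X 1 1 * t) (X 1 0) fun u v h ↦ hX u v (by linear_combination h))
  · obtain ⟨h1, h2⟩ := hY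
    simp only [mul_entry] at h2
    have hdet := Y.det_coe
    rw [Matrix.det_fin_two] at hdet
    show _ = _
    linear_combination (-X 1 0) * hdet + (X 1 0 * Y 0 0 + X 1 1 * Y 1 0) * h1 - Y 1 0 * h2
  · rintro Y ⟨hY1, hY2⟩ Z ⟨hZ1, hZ2⟩ h
    obtain ⟨h0, h1⟩ := Prod.mk.injEq .. ▸ h
    simp only [mul_entry] at hY2 hZ2
    have h11 : Y 1 1 = Z 1 1 := by linear_combination hY1 - hZ1 - h0
    refine ext_entries_s8 h0 (mul_left_cancel₀ hX10 ?_) h1 h11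
    linear_combination hY2 - hZ2 - X 0 0 * h0 - X 0 1 * h1 - X 1 1 * h11

theorem two_mul_ncard_le_ncard_preimage {p : ℕ} [Fact p.Prime] (hp : 2 < p)
    (A : Set PSL(2, ZMod p)) :
    2 * A.ncard ≤
      ((QuotientGroup.mk : SL(2, ZMod p) → PSL(2, ZMod p)) ⁻¹' A).ncard := by
  have hneg : ∀ g : SL(2, ZMod p), (QuotientGroup.mk (-g) : PSL(2, ZMod p)) = QuotientGroup.mk g :=
    fun g ↦ by
      rw [QuotientGroup.eq, mem_center_iff_isScalar, inv_neg, neg_mul, inv_mul_cancel]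
      simp [IsScalar]
  have hne : ∀ g : SL(2, ZMod p), -g ≠ g := fun g hg ↦ by
    have hzero : ∀ i j, g i j = 0 := fun i j ↦ by
      have h : -g i j = g i j := congrArg (fun k : SL(2, ZMod p) ↦ k i j) hg
      exact (mul_eq_zero.1 (by linear_combination -h)).resolve_left (two_ne_zero_zmod hp)
    have hdet := g.det_coe
    rw [Matrix.det_fin_two, hzero 0 0, hzero 0 1] at hdet
    simp at hdet
  let f : PSL(2, ZMod p) × Bool → SL(2, ZMod p) := fun y ↦ if y.2 then y.1.out else -y.1.out
  have hf : ∀ y, (QuotientGroup.mk (f y) : PSL(2, ZMod p)) = y.1 := by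
    rintro ⟨y, b⟩
    cases b
    · exact (hneg _).trans y.out_eq'
    · exact y.out_eq'
  have hinj : Function.Injective f := by
    rintro ⟨y, b⟩ ⟨z, c⟩ h
    obtain rfl : y = z := by
      have := congrArg (QuotientGroup.mk : SL(2, ZMod p) → PSL(2, ZMod p)) h
      rwa [hf, hf] at this
    cases b <;> cases c
    · rfl
    · exact absurd h (hne _)
    · exact absurd h.symm (hne _)
    · rfl
  have h := Set.ncard_le_ncard_of_injOn (s := A ×ˢ (Set.univ : Set Bool)) f
    (t := (QuotientGroup.mk : SL(2, ZMod p) → PSL(2, ZMod p)) ⁻¹' A)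
    (fun y hy ↦ by rw [Set.mem_preimage, hf]; exact hy.1) hinj.injOn
  rw [Set.ncard_prod, Set.ncard_univ, Nat.card_eq_fintype_card, Fintype.card_bool] at h
  omega

end Moebius

theorem coclique_bound_main3b (p : ℕ) (hp : p.Prime) (hp2 : 2 < p)
    (A : Set PSL(2, ZMod p)) (hA : IsMaximalCoclique A)
    (hnotmax : ∀ M : Subgroup PSL(2, ZMod p), IsCoatom M → A ≠ (M : Set PSL(2, ZMod p)))
    (x : PSL(2, ZMod p)) (hxA : x ∈ A) (hx2 : 2 < orderOf x)
    (hxdvd : orderOf x ∣ p + 1)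
    (hA5 : HasMaximalSubgroupIsoTo PSL(2, ZMod p) (alternatingGroup (Fin 5)))
    (hS4 : HasMaximalSubgroupIsoTo PSL(2, ZMod p) (Equiv.Perm (Fin 4))) :
    2 * A.ncard ≤ 93 * (p + 1) := by
  classical
  have : Fact p.Prime := ⟨hp⟩
  obtain ⟨X, rfl⟩ := QuotientGroup.mk_surjective x
  have hX := isAnisotropic_of_orderOf X hx2 hxdvd
  have hX2 : ¬ IsScalar (X ^ 2) := fun h ↦ by
    have h1 : (QuotientGroup.mk X : PSL(2, ZMod p)) ^ 2 = 1 := by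
      rw [← QuotientGroup.mk_pow, QuotientGroup.eq_one_iff]
      exact (mem_center_iff_isScalar _).2 h
    have := orderOf_le_of_pow_eq_one two_pos h1
    omega
  set R := (smallOrderPoly (ZMod p)).roots.toFinset with hR
  have hR9 : R.card ≤ 9 := (Multiset.toFinset_card_le _).trans
    ((Polynomial.card_roots' _).trans natDegree_smallOrderPoly.le)
  have hRp : R.card ≤ p := (Finset.card_le_univ R).trans (ZMod.card p).le
  have hmem : ∀ t, (smallOrderPoly (ZMod p)).IsRoot t → t ∈ R := fun t ht ↦ by
    rw [hR, Multiset.mem_toFinset, Polynomial.mem_roots smallOrderPoly_ne_zero]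
    exact ht
  have hcover : (QuotientGroup.mk : SL(2, ZMod p) → PSL(2, ZMod p)) ⁻¹' A ⊆
      {Y | X * Y = Y * X} ∪ ⋃ r ∈ R ×ˢ R,
        {Y | Y 0 0 + Y 1 1 = r.1 ∧ (X * Y) 0 0 + (X * Y) 1 1 = r.2} := by
    intro Y hY
    let π := QuotientGroup.mk' (Subgroup.center SL(2, ZMod p))
    have hH : (Subgroup.closure {π X, π Y}).comap π ≠ ⊤ := fun h ↦ hA.1 _ hxA _ hY
      (Subgroup.comap_injective (QuotientGroup.mk'_surjective _)
        (h.trans (Subgroup.comap_top _).symm))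
    have hneg : -1 ∈ (Subgroup.closure {π X, π Y}).comap π := by
      have h1 : π (-1) = 1 := (QuotientGroup.eq_one_iff _).2
        ((mem_center_iff_isScalar _).2 (by simp [IsScalar]))
      rw [Subgroup.mem_comap, h1]
      exact one_mem _
    rcases commute_or_isRoot_trace hp2 hH hneg hX hX2
      (Subgroup.subset_closure (.inl rfl) : π X ∈ Subgroup.closure {π X, π Y})
      (Subgroup.subset_closure (.inr rfl) : π Y ∈ Subgroup.closure {π X, π Y}) with h | ⟨h1, h2⟩
    · exact .inl h
    · exact .inr (Set.mem_biUnion (Finset.mem_coe.2 (Finset.mk_mem_product (hmem _ h1) (hmem _ h2)))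
        ⟨rfl, rfl⟩)
  have hunion : (⋃ r ∈ R ×ˢ R, {Y : SL(2, ZMod p) |
      Y 0 0 + Y 1 1 = r.1 ∧ (X * Y) 0 0 + (X * Y) 1 1 = r.2}).ncard ≤
        R.card * R.card * (p + 2) := by
    refine (Finset.set_ncard_biUnion_le _ _).trans ?_
    rw [← Finset.card_product]
    refine Finset.sum_le_card_nsmul _ _ _ fun r _ ↦ ?_
    simpa using ncard_trace_eq_le hX r.1 r.2
  have hcomm : {Y | X * Y = Y * X}.ncard ≤ p + 2 := by simpa using ncard_commuting_le hX
  have htotal := (two_mul_ncard_le_ncard_preimage hp2 A).trans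
    ((Set.ncard_le_ncard hcover (Set.toFinite _)).trans (Set.ncard_union_le _ _))
  have hsq : R.card * R.card * (p + 2) + (p + 2) ≤ 93 * (p + 1) := by
    rcases le_or_gt 7 p with h7 | h7
    · nlinarith [Nat.mul_le_mul_right (p + 2) (Nat.mul_le_mul hR9 hR9)]
    · have := Nat.mul_le_mul_right (p + 2) (Nat.mul_le_mul hRp hRp)
      interval_cases p <;> omega
  omega
end
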